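/- arXiv:2401.10803 — 4 statements merged into one kernel-verified Lean document; each statement's English description precedes it below -/
import Mathlib

section
/- Let n be a positive integer and let G be a simple graph on a vertex set V with |V| = n. Suppose that (P1) for every pair of disjoint sets U, W ⊆ V with |U| ≥ n/15 and |W| ≥ n/15 there exist u ∈ U and w ∈ W that are adjacent in G, and (P2) for every set U ⊆ V with n/15 ≤ |U| < n there exists a vertex v ∈ V ∖ U having at least two neighbors in U. Then G is globally rigid in ℝ. -/
/-- A graph `G` is globally rigid in `ℝ` if any two injective embeddings of its
vertices into `ℝ` which agree on the distances along edges agree on all pairwise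
distances. -/
def GloballyRigid {V : Type*} (G : SimpleGraph V) : Prop :=
  ∀ f g : V → ℝ, Function.Injective f → Function.Injective g →
    (∀ x y : V, G.Adj x y → |f x - f y| = |g x - g y|) →
    ∀ x y : V, |f x - f y| = |g x - g y|

open Classical in
/-- If all fibres of `p` are smaller than `c`, some threshold `t` splits the domain into a part
of size at least `2 * c` and a complement of size more than `|V| - 3 * c`. -/
lemma exists_balanced_threshold {V : Type*} [Fintype V] [Nonempty V] (p : V → ℝ) (c : ℝ)
    (hc : 2 * c ≤ Fintype.card V)
    (hfib : ∀ t, ((Finset.univ.filter fun v => p v = t).card : ℝ) < c) :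
    ∃ t, 2 * c ≤ ((Finset.univ.filter fun v => p v ≤ t).card : ℝ) ∧
      (Fintype.card V : ℝ) - 3 * c < ((Finset.univ.filter fun v => ¬ p v ≤ t).card : ℝ) := by
  have hc0 : 0 < c := lt_of_le_of_lt (Nat.cast_nonneg _) (hfib 0)
  obtain ⟨m, -, hm⟩ := Finset.exists_max_image Finset.univ p Finset.univ_nonempty
  have hne : (Finset.univ.filter fun w =>
      2 * c ≤ ((Finset.univ.filter fun v => p v ≤ p w).card : ℝ)).Nonempty := by
    refine ⟨m, Finset.mem_filter.2 ⟨Finset.mem_univ _, ?_⟩⟩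
    rw [Finset.filter_true_of_mem fun v _ => hm v (Finset.mem_univ v)]
    exact hc
  obtain ⟨w, hw, hmin⟩ := Finset.exists_min_image _ p hne
  refine ⟨p w, (Finset.mem_filter.1 hw).2, ?_⟩
  have hlt : ((Finset.univ.filter fun v => p v < p w).card : ℝ) < 2 * c := by
    rcases (Finset.univ.filter fun v => p v < p w).eq_empty_or_nonempty with h | h
    · rw [h]
      simpa using hc0
    · obtain ⟨u, hu, hmax⟩ := Finset.exists_max_image _ p h
      have huw : p u < p w := (Finset.mem_filter.1 hu).2
      by_contra! hge
      refine (hmin u (Finset.mem_filter.2 ⟨Finset.mem_univ _, hge.trans ?_⟩)).not_gt huw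
      exact_mod_cast Finset.card_le_card fun v hv =>
        Finset.mem_filter.2 ⟨Finset.mem_univ _, hmax v hv⟩
  have hsplit : (Finset.univ.filter fun v => p v ≤ p w).card ≤
      (Finset.univ.filter fun v => p v < p w).card +
        (Finset.univ.filter fun v => p v = p w).card := by
    refine le_trans (Finset.card_le_card fun v hv => ?_) (Finset.card_union_le _ _)
    simpa [le_iff_lt_or_eq] using hv
  have htotal := Finset.card_filter_add_card_filter_not (s := Finset.univ) fun v => p v ≤ p w
  rw [Finset.card_univ] at htotal
  have hfw := hfib (p w)
  rify at hsplit htotal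
  linarith

open Classical in
/-- If every edge of `G` is constant in one of two coordinates that jointly separate vertices,
and every sufficiently large proper vertex set has an outside vertex with two neighbours in it,
then a coordinate with one large fibre is constant. -/
lemma eq_of_large_fiber {V : Type*} [Fintype V] (G : SimpleGraph V) (c : ℝ) (p q : V → ℝ)
    (hinj : ∀ x y, p x = p y → q x = q y → x = y)
    (hadj : ∀ x y, G.Adj x y → p x = p y ∨ q x = q y)
    (hext : ∀ U : Finset V, c ≤ U.card → U.card < Fintype.card V →
      ∃ v : V, v ∉ U ∧ 2 ≤ {u : V | u ∈ U ∧ G.Adj v u}.ncard)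
    (t : ℝ) (ht : c ≤ ((Finset.univ.filter fun v => p v = t).card : ℝ)) (x : V) : p x = t := by
  by_contra hx
  obtain ⟨v, hv, h2⟩ := hext _ ht (Finset.card_lt_univ_of_notMem (x := x) (by simpa using hx))
  obtain ⟨a, b, ⟨ha, hva⟩, ⟨hb, hvb⟩, hab⟩ := (Set.one_lt_ncard_iff (Set.toFinite _)).1 h2
  simp only [Finset.mem_filter, Finset.mem_univ, true_and] at hv ha hb
  have hqa := (hadj v a hva).resolve_left fun h => hv (h.trans ha)
  have hqb := (hadj v b hvb).resolve_left fun h => hv (h.trans hb)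
  exact hab (hinj a b (ha.trans hb.symm) (hqa.symm.trans hqb))

open Classical in
/-- If every edge of `G` is constant in one of two coordinates and any two disjoint sets of
size at least `c` are joined by an edge, where `5 * c ≤ |V|`, then one of the coordinates has a
fibre of size at least `c`. -/
lemma exists_large_fiber {V : Type*} [Fintype V] [Nonempty V] (G : SimpleGraph V) (c : ℝ)
    (hc : 5 * c ≤ Fintype.card V) (p q : V → ℝ)
    (hadj : ∀ x y, G.Adj x y → p x = p y ∨ q x = q y)
    (hedge : ∀ U W : Finset V, Disjoint U W → c ≤ U.card → c ≤ W.card →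
      ∃ u ∈ U, ∃ w ∈ W, G.Adj u w) :
    (∃ t, c ≤ ((Finset.univ.filter fun v => p v = t).card : ℝ)) ∨
      ∃ t, c ≤ ((Finset.univ.filter fun v => q v = t).card : ℝ) := by
  by_contra! h
  have hc0 : 0 < c := lt_of_le_of_lt (Nat.cast_nonneg _) (h.1 0)
  obtain ⟨s, hs1, hs2⟩ := exists_balanced_threshold p c (by linarith) h.1
  obtain ⟨t, ht1, ht2⟩ := exists_balanced_threshold q c (by linarith) h.2
  have hp := fun (r : V → Prop) [DecidablePred r] => Finset.card_filter_add_card_filter_not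
    (s := Finset.univ.filter r) fun v => q v ≤ t
  have hq := fun (r : V → Prop) [DecidablePred r] => Finset.card_filter_add_card_filter_not
    (s := Finset.univ.filter r) fun v => p v ≤ s
  have h1 := hp fun v => p v ≤ s
  have h2 := hp fun v => ¬ p v ≤ s
  have h3 := hq fun v => q v ≤ t
  have h4 := hq fun v => ¬ q v ≤ t
  simp only [Finset.filter_filter] at h1 h2 h3 h4
  simp only [and_comm (a := q _ ≤ t), and_comm (a := ¬ q _ ≤ t)] at h3 h4
  have hdiag : ¬ (c ≤ ((Finset.univ.filter fun v => p v ≤ s ∧ q v ≤ t).card : ℝ) ∧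
      c ≤ ((Finset.univ.filter fun v => ¬ p v ≤ s ∧ ¬ q v ≤ t).card : ℝ)) := by
    rintro ⟨hU, hW⟩
    obtain ⟨u, hu, w, hw, huw⟩ := hedge _ _
      (Finset.disjoint_filter.2 fun v _ hv hv' => hv'.1 hv.1) hU hW
    simp only [Finset.mem_filter, Finset.mem_univ, true_and] at hu hw
    rcases hadj u w huw with e | e
    · exact hw.1 (e ▸ hu.1)
    · exact hw.2 (e ▸ hu.2)
  have hanti : ¬ (c ≤ ((Finset.univ.filter fun v => p v ≤ s ∧ ¬ q v ≤ t).card : ℝ) ∧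
      c ≤ ((Finset.univ.filter fun v => ¬ p v ≤ s ∧ q v ≤ t).card : ℝ)) := by
    rintro ⟨hU, hW⟩
    obtain ⟨u, hu, w, hw, huw⟩ := hedge _ _
      (Finset.disjoint_filter.2 fun v _ hv hv' => hv'.1 hv.1) hU hW
    simp only [Finset.mem_filter, Finset.mem_univ, true_and] at hu hw
    rcases hadj u w huw with e | e
    · exact hw.1 (e ▸ hu.1)
    · exact hu.2 (e ▸ hw.2)
  rify at h1 h2 h3 h4
  rw [not_and_or, not_le, not_le] at hdiag hanti
  rcases hdiag with hd | hd <;> rcases hanti with ha | ha <;> linarith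

theorem stmt0 {V : Type*} [Fintype V] (n : ℕ) (hn : 0 < n)
    (hcard : Fintype.card V = n) (G : SimpleGraph V)
    (hP1 : ∀ U W : Finset V, Disjoint U W →
      (n : ℝ) / 15 ≤ U.card → (n : ℝ) / 15 ≤ W.card →
      ∃ u ∈ U, ∃ w ∈ W, G.Adj u w)
    (hP2 : ∀ U : Finset V, (n : ℝ) / 15 ≤ U.card → U.card < n →
      ∃ v : V, v ∉ U ∧ 2 ≤ {u : V | u ∈ U ∧ G.Adj v u}.ncard) :
    GloballyRigid G := by
  intro f g hf _ hfg x y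
  subst hcard
  have : Nonempty V := Fintype.card_pos_iff.1 hn
  have hadj : ∀ x y, G.Adj x y → f x - g x = f y - g y ∨ f x + g x = f y + g y := by
    intro x y hxy
    rcases abs_eq_abs.1 (hfg x y hxy) with h | h
    · left; linarith
    · right; linarith
  have hinj : ∀ x y, f x - g x = f y - g y → f x + g x = f y + g y → x = y :=
    fun x y h1 h2 => hf (by linarith)
  have hn0 : (0 : ℝ) < Fintype.card V := by exact_mod_cast hn
  rw [abs_eq_abs]
  rcases exists_large_fiber G ((Fintype.card V : ℝ) / 15) (by linarith)
    (fun v => f v - g v) (fun v => f v + g v) hadj hP1 with ⟨t, ht⟩ | ⟨t, ht⟩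
  · have key := eq_of_large_fiber G _ (fun v => f v - g v) (fun v => f v + g v) hinj hadj hP2 t ht
    have hx := key x
    have hy := key y
    left; linarith
  · have key := eq_of_large_fiber G _ (fun v => f v + g v) (fun v => f v - g v)
      (fun x y h1 h2 => hinj x y h2 h1) (fun x y h => (hadj x y h).symm) hP2 t ht
    have hx := key x
    have hy := key y
    right; linarith
end

section
/- Let G be a finite simple graph whose vertex set V is partitioned into two nonempty sets A and B such that every vertex of A has at most one neighbor in B and every vertex of B has at most one neighbor in A. Suppose moreover that G is not the complete graph on two vertices (i.e., it is not the case that |V| = 2 and the two vertices of G are adjacent). Then G is not globally rigid in ℝ. -/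
/-- If `p` is injective on `A` and on its complement, then shifting the complement up or down by
one, relative to an even-integer placement of the values of `p`, gives an injective placement. -/
lemma injective_shift {V : Type*} (e : V → ℤ) (he : Function.Injective e) (A : Set V)
    [DecidablePred (· ∈ A)] (p : V → V) (hpA : Set.InjOn p A) (hpB : Set.InjOn p Aᶜ)
    (c : ℤ) (hc : Odd c) :
    Function.Injective fun v => ((2 * e (p v) + if v ∈ A then 0 else c : ℤ) : ℝ) := by
  intro u v huv
  have h : 2 * e (p u) + (if u ∈ A then 0 else c) = 2 * e (p v) + (if v ∈ A then 0 else c) :=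
    Int.cast_injective huv
  obtain ⟨k, rfl⟩ := hc
  by_cases hu : u ∈ A <;> by_cases hv : v ∈ A <;> simp only [hu, hv, if_true, if_false] at h
  · exact hpA hu hv (he (by omega))
  · omega
  · omega
  · exact hpB hu hv (he (by omega))

/-- A graph is not globally rigid if its vertices can be projected so that the projection is
injective on both sides of a cut, and the pairs across the cut with the same image include all
edges across the cut but not all pairs. -/
lemma not_globallyRigid_of_projection {V : Type*} [Finite V] (G : SimpleGraph V) (A : Set V)
    (p : V → V) (hpA : Set.InjOn p A) (hpB : Set.InjOn p Aᶜ)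
    (hadj : ∀ a ∈ A, ∀ b ∉ A, G.Adj a b → p a = p b)
    (hne : ∃ a ∈ A, ∃ b ∉ A, p a ≠ p b) : ¬ GloballyRigid G := by
  classical
  obtain ⟨n, ⟨e₀⟩⟩ := Finite.exists_equiv_fin V
  let e : V → ℤ := fun v => ((e₀ v : ℕ) : ℤ)
  have he : Function.Injective e := fun u v h =>
    e₀.injective (Fin.ext (Int.ofNat_injective h))
  intro hG
  obtain ⟨a, ha, b, hb, hab⟩ := hne
  have key := hG _ _ (injective_shift e he A p hpA hpB 1 (by decide))
    (injective_shift e he A p hpA hpB (-1) (by decide)) ?_ a b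
  · have h : |2 * e (p a) - (2 * e (p b) + 1)| = |2 * e (p a) - (2 * e (p b) + -1)| := by
      simp only [ha, hb, if_true, if_false, add_zero] at key
      exact_mod_cast key
    refine hab (he ?_)
    rcases abs_eq_abs.mp h with h | h <;> omega
  · intro x y hxy
    by_cases hx : x ∈ A <;> by_cases hy : y ∈ A <;> simp only [hx, hy, if_true, if_false]
    · rw [hadj x hx y hy hxy]
      simp
    · rw [hadj y hy x hx hxy.symm]
      simp
    · push_cast
      congr 1
      ring

theorem stmt1 {V : Type*} [Fintype V] (G : SimpleGraph V) (A B : Set V)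
    (hA : A.Nonempty) (hB : B.Nonempty) (hdisj : Disjoint A B)
    (hcover : A ∪ B = Set.univ)
    (hAB : ∀ a ∈ A, {b : V | b ∈ B ∧ G.Adj a b}.ncard ≤ 1)
    (hBA : ∀ b ∈ B, {a : V | a ∈ A ∧ G.Adj b a}.ncard ≤ 1)
    (hK2 : ¬ (Fintype.card V = 2 ∧ ∀ x y : V, x ≠ y → G.Adj x y)) :
    ¬ GloballyRigid G := by
  classical
  obtain rfl : B = Aᶜ :=
    (IsCompl.compl_eq ⟨hdisj, codisjoint_iff.mpr hcover⟩).symm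
  have uA : ∀ a ∈ A, ∀ b ∉ A, ∀ b' ∉ A, G.Adj a b → G.Adj a b' → b = b' :=
    fun a ha b hb b' hb' h h' =>
      (Set.ncard_le_one (Set.toFinite _)).mp (hAB a ha) b ⟨hb, h⟩ b' ⟨hb', h'⟩
  have uB : ∀ b ∉ A, ∀ a ∈ A, ∀ a' ∈ A, G.Adj b a → G.Adj b a' → a = a' :=
    fun b hb a ha a' ha' h h' =>
      (Set.ncard_le_one (Set.toFinite _)).mp (hBA b hb) a ⟨ha, h⟩ a' ⟨ha', h'⟩
  let p : V → V := fun v => if h : v ∉ A ∧ ∃ a ∈ A, G.Adj v a then h.2.choose else v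
  have pA : ∀ a ∈ A, p a = a := fun a ha => dif_neg fun h => h.1 ha
  have pB : ∀ b ∉ A, (p b ∈ A ∧ G.Adj b (p b)) ∨ ((∀ a ∈ A, ¬ G.Adj b a) ∧ p b = b) := by
    intro b hb
    by_cases h : ∃ a ∈ A, G.Adj b a
    · have hp : p b = h.choose := dif_pos ⟨hb, h⟩
      rw [hp]
      exact Or.inl h.choose_spec
    · exact Or.inr ⟨fun a ha hab => h ⟨a, ha, hab⟩, dif_neg fun h' => h h'.2⟩
  refine not_globallyRigid_of_projection G A p ?_ ?_ ?_ ?_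
  · intro u hu v hv h
    rwa [pA u hu, pA v hv] at h
  · intro u hu v hv h
    rcases pB u hu with ⟨hu1, hu2⟩ | ⟨-, hu2⟩ <;> rcases pB v hv with ⟨hv1, hv2⟩ | ⟨-, hv2⟩
    · exact uA (p u) hu1 u hu v hv hu2.symm (h ▸ hv2.symm)
    · exact absurd (hv2 ▸ h ▸ hu1) hv
    · exact absurd (hu2 ▸ h ▸ hv1) hu
    · rwa [hu2, hv2] at h
  · intro a ha b hb hab
    rw [pA a ha]
    rcases pB b hb with ⟨h1, h2⟩ | ⟨h, -⟩
    · exact uB b hb a ha (p b) h1 hab.symm h2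
    · exact absurd hab.symm (h a ha)
  · by_contra! hall
    have hadj : ∀ a ∈ A, ∀ b ∉ A, G.Adj a b := by
      intro a ha b hb
      have hp := hall a ha b hb
      rw [pA a ha] at hp
      rcases pB b hb with ⟨-, h2⟩ | ⟨-, h⟩
      · exact hp ▸ h2.symm
      · exact absurd (h ▸ hp ▸ ha) hb
    obtain ⟨a, ha⟩ := hA
    obtain ⟨b, hb⟩ := hB
    have eqA : ∀ x ∈ A, x = a := fun x hx =>
      uB b hb x hx a ha (hadj x hx b hb).symm (hadj a ha b hb).symm
    have eqB : ∀ x ∉ A, x = b := fun x hx =>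
      uA a ha x hx b hb (hadj a ha x hx) (hadj a ha b hb)
    have hne : a ≠ b := fun h => hb (h ▸ ha)
    refine hK2 ⟨?_, fun x y hxy => ?_⟩
    · rw [← Finset.card_univ, Finset.card_eq_two]
      refine ⟨a, b, hne, ?_⟩
      ext x
      by_cases hx : x ∈ A
      · simp [eqA x hx]
      · simp [eqB x hx]
    · by_cases hx : x ∈ A <;> by_cases hy : y ∈ A
      · exact absurd ((eqA x hx).trans (eqA y hy).symm) hxy
      · exact hadj x hx y hy
      · exact (hadj y hy x hx).symm
      · exact absurd ((eqB x hx).trans (eqB y hy).symm) hxy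
end

section
/- For every δ > 0 there exists N such that for every n ≥ N the following holds. Let M = n(n−1)/2 and, for each bijection σ from {1, …, M} to the edge set of the complete graph on vertex set Fin n, let G_m(σ) denote the simple graph on Fin n whose edges are σ(1), …, σ(m), and let τ(σ) be the least m such that every vertex of G_m(σ) has degree at least 2. Then the number of bijections σ for which G_{τ(σ)}(σ) is globally rigid in ℝ is at least (1 − δ) · M!. (In other words, at the hitting time of minimum degree 2, the random graph process is globally rigid in ℝ with high probability.) -/
/-- The graph obtained after `m` steps of the random graph process given by the
ordering `σ` of the edges of the complete graph on `Fin n`. -/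
def processGraph (n m : ℕ)
    (σ : Fin (n * (n - 1) / 2) ≃ (⊤ : SimpleGraph (Fin n)).edgeSet) :
    SimpleGraph (Fin n) :=
  SimpleGraph.fromEdgeSet
    {e : Sym2 (Fin n) | ∃ i : Fin (n * (n - 1) / 2), (i : ℕ) < m ∧ (σ i : Sym2 (Fin n)) = e}

/-- The hitting time of minimum degree `2` in the random graph process `σ`. -/
noncomputable def hittingTimeMinDeg2 (n : ℕ)
    (σ : Fin (n * (n - 1) / 2) ≃ (⊤ : SimpleGraph (Fin n)).edgeSet) : ℕ :=
  sInf {m : ℕ | ∀ v : Fin n, 2 ≤ ((processGraph n m σ).neighborSet v).ncard}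


open Finset

open Classical in
/-- The probability of the event `p` under the uniform distribution on `Ω`. -/
noncomputable def unifProb {Ω : Type*} [Fintype Ω] (p : Ω → Prop) : ℝ :=
  (#{ω | p ω} : ℝ) / Fintype.card Ω

section UnifProb

variable {Ω : Type*} [Fintype Ω]

lemma unifProb_nonneg (p : Ω → Prop) : 0 ≤ unifProb p := by
  unfold unifProb; positivity

lemma unifProb_eq (p : Ω → Prop) [DecidablePred p] :
    unifProb p = (#{ω | p ω} : ℝ) / Fintype.card Ω := by
  unfold unifProb
  congr!

lemma unifProb_mono {p q : Ω → Prop} (h : ∀ ω, p ω → q ω) : unifProb p ≤ unifProb q := by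
  classical
  unfold unifProb
  refine div_le_div_of_nonneg_right ?_ (Nat.cast_nonneg _)
  exact_mod_cast card_le_card fun ω => by simpa using h ω

lemma unifProb_exists_le {ι : Type*} (s : Finset ι) (p : ι → Ω → Prop) :
    unifProb (fun ω => ∃ i ∈ s, p i ω) ≤ ∑ i ∈ s, unifProb (p i) := by
  classical
  simp only [unifProb_eq]
  rw [← sum_div]
  refine div_le_div_of_nonneg_right ?_ (Nat.cast_nonneg _)
  have : ({ω | ∃ i ∈ s, p i ω} : Finset Ω) = s.biUnion fun i => {ω | p i ω} := by
    ext; simp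
  rw [this]
  exact_mod_cast card_biUnion_le

lemma unifProb_or_le (p q : Ω → Prop) :
    unifProb (fun ω => p ω ∨ q ω) ≤ unifProb p + unifProb q := by
  classical
  simp only [unifProb_eq]
  rw [← add_div]
  refine div_le_div_of_nonneg_right ?_ (Nat.cast_nonneg _)
  rw [filter_or]
  exact_mod_cast card_union_le _ _

lemma unifProb_true [Nonempty Ω] : unifProb (fun _ : Ω => True) = 1 := by
  simp [unifProb]

lemma unifProb_not [Nonempty Ω] (p : Ω → Prop) : unifProb (fun ω => ¬ p ω) = 1 - unifProb p := by
  classical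
  have h := card_filter_add_card_filter_not (s := (univ : Finset Ω)) p
  have hpos : (0 : ℝ) < Fintype.card Ω := by exact_mod_cast Fintype.card_pos
  rw [unifProb_eq, unifProb_eq, eq_sub_iff_add_eq, ← add_div, div_eq_one_iff_eq hpos.ne']
  rw [card_univ] at h
  exact_mod_cast (add_comm _ _).trans h

lemma one_sub_le_unifProb [Nonempty Ω] (p q : Ω → Prop) (h : ∀ ω, ¬ p ω → q ω) :
    1 - unifProb p ≤ unifProb q := by
  have h1 : unifProb (fun ω : Ω => p ω ∨ q ω) = 1 := by
    rw [← unifProb_true (Ω := Ω)]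
    congr 1
    ext ω
    by_cases hp : p ω <;> simp [hp, h]
  linarith [unifProb_or_le p q]

/-- The second moment method: if `n` events each have probability `a` and pairwise intersections
have probability at most `b`, then the union has probability at least `(na)² / (na + n²b)`. -/
lemma second_moment {ι : Type*} [Fintype ι] (p : ι → Ω → Prop) (a b : ℝ)
    (ha : ∀ i, unifProb (p i) = a)
    (hb : ∀ i j, i ≠ j → unifProb (fun ω => p i ω ∧ p j ω) ≤ b) (hb0 : 0 ≤ b) :
    (Fintype.card ι * a) ^ 2 ≤ unifProb (fun ω => ∃ i, p i ω) *
      (Fintype.card ι * a + Fintype.card ι ^ 2 * b) := by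
  classical
  rcases isEmpty_or_nonempty Ω with hΩ | hΩ
  · have ha0 : ∀ i : ι, a = 0 := fun i => by rw [← ha i]; simp [unifProb]
    rcases isEmpty_or_nonempty ι with hι | ⟨⟨i⟩⟩
    · simp
    · simp [ha0 i, unifProb]
  obtain ⟨N, hN⟩ : ∃ N : ℝ, N = Fintype.card Ω := ⟨_, rfl⟩
  have hNpos : 0 < N := by rw [hN]; exact_mod_cast Fintype.card_pos
  let X : Ω → ℝ := fun ω => ∑ i, if p i ω then 1 else 0
  have key : ∀ (q : Ω → Prop) [DecidablePred q], ∑ ω, (if q ω then (1 : ℝ) else 0) = N * unifProb q := by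
    intro q _
    rw [sum_boole, unifProb_eq, ← hN, mul_div_cancel₀ _ hNpos.ne']
  have hX : ∑ ω, X ω = N * (Fintype.card ι * a) := by
    simp only [X]
    rw [sum_comm]
    simp only [key, ha]
    simp
    ring
  have hX2 : ∑ ω, X ω ^ 2 ≤ N * (Fintype.card ι * a + Fintype.card ι ^ 2 * b) := by
    have : ∀ ω, X ω ^ 2 = ∑ i, ∑ j, if p i ω ∧ p j ω then (1 : ℝ) else 0 := by
      intro ω
      simp only [X, sq, sum_mul_sum]
      refine sum_congr rfl fun i _ => sum_congr rfl fun j _ => ?_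
      by_cases h1 : p i ω <;> by_cases h2 : p j ω <;> simp [h1, h2]
    simp only [this]
    rw [sum_comm]
    have h2 : ∀ i, ∑ ω, ∑ j, (if p i ω ∧ p j ω then (1 : ℝ) else 0) ≤
        N * (a + Fintype.card ι * b) := by
      intro i
      rw [sum_comm]
      simp only [key]
      rw [← mul_sum]
      gcongr
      calc ∑ j, unifProb (fun ω => p i ω ∧ p j ω)
          ≤ ∑ j, ((if i = j then a else 0) + b) := by
            refine sum_le_sum fun j _ => ?_
            by_cases h : i = j
            · subst h; simp [ha, hb0]
            · simpa [h] using hb i j h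
        _ = a + Fintype.card ι * b := by simp [sum_add_distrib]
    calc _ ≤ ∑ _i : ι, N * (a + Fintype.card ι * b) := sum_le_sum fun i _ => h2 i
      _ = _ := by simp; ring
  have hcs := sq_sum_le_card_mul_sum_sq (s := ({ω | ∃ i, p i ω} : Finset Ω)) (f := X)
  have hs : ∑ ω ∈ ({ω | ∃ i, p i ω} : Finset Ω), X ω = ∑ ω, X ω := by
    refine sum_subset (subset_univ _) fun ω _ h => ?_
    simp only [mem_filter, mem_univ, true_and, not_exists] at h
    simp [X, h]
  have hcard : (#{ω | ∃ i, p i ω} : ℝ) = N * unifProb (fun ω => ∃ i, p i ω) := by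
    rw [unifProb_eq, ← hN, mul_div_cancel₀ _ hNpos.ne']
  have hs2 : ∑ ω ∈ ({ω | ∃ i, p i ω} : Finset Ω), X ω ^ 2 ≤ ∑ ω, X ω ^ 2 :=
    sum_le_univ_sum_of_nonneg fun ω => sq_nonneg _
  rw [hs, hX, hcard] at hcs
  have h3 := hcs.trans (mul_le_mul_of_nonneg_left (hs2.trans hX2)
    (mul_nonneg hNpos.le (unifProb_nonneg _)))
  have h4 : N ^ 2 * (Fintype.card ι * a) ^ 2 ≤ N ^ 2 * (unifProb (fun ω => ∃ i, p i ω) *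
      (Fintype.card ι * a + Fintype.card ι ^ 2 * b)) := by
    nlinarith [h3]
  exact le_of_mul_le_mul_left h4 (by positivity)

end UnifProb

section RandomBijection

variable {P E : Type*} [Fintype P] [DecidableEq P] [Fintype E] [DecidableEq E]

omit [Fintype E] [DecidableEq E] in
/-- Revealing the position of one more element in a uniformly random bijection, when the
positions of the elements of `T` are already known. -/
lemma card_reveal (X : Finset (P ≃ E)) (T : Finset E) (e : E) (he : e ∉ T)
    (hX : ∀ σ σ' : P ≃ E, (∀ x ∈ T, σ.symm x = σ'.symm x) → σ ∈ X → σ' ∈ X) (Q : Finset P) :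
    #{σ ∈ X | σ.symm e ∈ Q} * (Fintype.card P - #T) = ∑ σ ∈ X, #(Q \ T.image σ.symm) := by
  have hcard : ∀ σ : P ≃ E, #(univ \ T.image σ.symm) = Fintype.card P - #T := by
    intro σ
    rw [card_sdiff_of_subset (subset_univ _), card_image_of_injective _ σ.symm.injective, card_univ]
  calc _ = ∑ σ ∈ X with σ.symm e ∈ Q, #(univ \ T.image σ.symm) := by simp [hcard]
    _ = _ := by
      rw [← card_sigma, ← card_sigma]
      let F : (Σ _ : P ≃ E, P) → (Σ _ : P ≃ E, P) := fun x =>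
        ⟨(Equiv.swap x.2 (x.1.symm e)).trans x.1, x.1.symm e⟩
      have hF : ∀ x, F (F x) = x := by
        rintro ⟨σ, q⟩
        ext <;> simp [F, Equiv.swap_comm]
      have hT : ∀ (σ : P ≃ E) (q : P), q ∉ T.image σ.symm → ∀ x ∈ T,
          (F ⟨σ, q⟩).1.symm x = σ.symm x := by
        intro σ q hq x hx
        simp only [F, Equiv.symm_trans_apply, Equiv.symm_swap]
        apply Equiv.swap_apply_of_ne_of_ne
        · rintro rfl; exact hq (mem_image_of_mem _ hx)
        · intro h; exact he (σ.symm.injective h ▸ hx)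
      have he' : ∀ (σ : P ≃ E), σ.symm e ∉ T.image σ.symm := by
        intro σ h
        obtain ⟨x, hx, h⟩ := mem_image.1 h
        exact he (σ.symm.injective h ▸ hx)
      have hI : ∀ (σ : P ≃ E) (q : P), q ∉ T.image σ.symm →
          T.image (F ⟨σ, q⟩).1.symm = T.image σ.symm := fun σ q hq =>
        image_congr fun x hx => hT σ q hq x hx
      refine card_nbij' F F ?_ ?_ (fun x _ => hF x) (fun x _ => hF x)
      · rintro ⟨σ, q⟩ h
        simp only [coe_sigma, Set.mem_sigma_iff, mem_coe, mem_filter, mem_sdiff, mem_univ,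
          true_and] at h ⊢
        refine ⟨hX σ _ (fun x hx => (hT σ q h.2 x hx).symm) h.1.1, h.1.2, ?_⟩
        rw [hI σ q h.2]
        exact he' σ
      · rintro ⟨σ, q⟩ h
        simp only [coe_sigma, Set.mem_sigma_iff, mem_coe, mem_filter, mem_sdiff, mem_univ,
          true_and] at h ⊢
        refine ⟨⟨hX σ _ (fun x hx => (hT σ q h.2.2 x hx).symm) h.1, ?_⟩, ?_⟩
        · simpa [F] using h.2.1
        · rw [hI σ q h.2.2]
          exact he' σ

lemma unifProb_reveal_le (p : (P ≃ E) → Prop) (T : Finset E) (e : E) (he : e ∉ T)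
    (hp : ∀ σ σ' : P ≃ E, (∀ x ∈ T, σ.symm x = σ'.symm x) → p σ → p σ') (Q : Finset P) (c : ℕ)
    (hc : ∀ σ, p σ → #(Q \ T.image σ.symm) ≤ c) :
    unifProb (fun σ : P ≃ E => p σ ∧ σ.symm e ∈ Q) * ((Fintype.card P - #T : ℕ) : ℝ) ≤
      unifProb p * c := by
  classical
  have h := card_reveal {σ | p σ} T e he (by simpa using hp) Q
  have h2 : ∑ σ ∈ ({σ | p σ} : Finset (P ≃ E)), #(Q \ T.image σ.symm) ≤ #{σ | p σ} * c :=
    sum_le_card_nsmul _ _ _ (by simpa using hc)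
  rw [← h, filter_filter] at h2
  simp only [unifProb_eq]
  rw [div_mul_eq_mul_div, div_mul_eq_mul_div]
  refine div_le_div_of_nonneg_right ?_ (Nat.cast_nonneg _)
  exact_mod_cast h2

lemma unifProb_reveal_eq (p : (P ≃ E) → Prop) (T : Finset E) (e : E) (he : e ∉ T)
    (hp : ∀ σ σ' : P ≃ E, (∀ x ∈ T, σ.symm x = σ'.symm x) → p σ → p σ') (Q : Finset P) (c : ℕ)
    (hc : ∀ σ, p σ → #(Q \ T.image σ.symm) = c) :
    unifProb (fun σ : P ≃ E => p σ ∧ σ.symm e ∈ Q) * ((Fintype.card P - #T : ℕ) : ℝ) =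
      unifProb p * c := by
  classical
  have h := card_reveal {σ | p σ} T e he (by simpa using hp) Q
  have h2 : ∑ σ ∈ ({σ | p σ} : Finset (P ≃ E)), #(Q \ T.image σ.symm) = #{σ | p σ} * c :=
    sum_const_nat (by simpa using hc)
  rw [← h, filter_filter] at h2
  simp only [unifProb_eq]
  rw [div_mul_eq_mul_div, div_mul_eq_mul_div]
  congr 1
  exact_mod_cast h2

lemma unifProb_subset_le [Nonempty (P ≃ E)] (J : Finset P) (d : ℕ) (hd : d < Fintype.card P)
    (D : Finset E) (hD : #D ≤ d) :
    unifProb (fun σ : P ≃ E => ∀ e ∈ D, σ.symm e ∈ J) ≤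
      ((#J : ℝ) / (Fintype.card P - d)) ^ #D := by
  have hd' : (0 : ℝ) < Fintype.card P - d := by
    rw [sub_pos]; exact_mod_cast hd
  induction D using Finset.induction_on with
  | empty => simp [unifProb_true]
  | insert e D he ih =>
    rw [card_insert_of_notMem he] at hD ⊢
    have h := unifProb_reveal_le (fun σ : P ≃ E => ∀ e ∈ D, σ.symm e ∈ J) D e he
      (fun σ σ' h hσ x hx => h x hx ▸ hσ x hx) J #J (fun σ _ => card_le_card sdiff_subset)
    have hpos : (Fintype.card P - d : ℝ) ≤ ((Fintype.card P - #D : ℕ) : ℝ) := by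
      rw [Nat.cast_sub (by omega)]
      have : (#D : ℝ) ≤ d := by exact_mod_cast (by omega : #D ≤ d)
      linarith
    calc unifProb (fun σ : P ≃ E => ∀ x ∈ insert e D, σ.symm x ∈ J)
        ≤ unifProb (fun σ : P ≃ E => (∀ e ∈ D, σ.symm e ∈ J) ∧ σ.symm e ∈ J) :=
          unifProb_mono fun σ h => ⟨fun x hx => h x (mem_insert_of_mem hx),
            h e (mem_insert_self _ _)⟩
      _ ≤ unifProb (fun σ : P ≃ E => ∀ e ∈ D, σ.symm e ∈ J) * #J / (Fintype.card P - d) := by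
          rw [le_div_iff₀ hd']
          exact (mul_le_mul_of_nonneg_left hpos (unifProb_nonneg _)).trans h
      _ = unifProb (fun σ : P ≃ E => ∀ e ∈ D, σ.symm e ∈ J) * (#J / (Fintype.card P - d)) := by
          ring
      _ ≤ _ := by
          rw [pow_succ]
          gcongr
          exact ih (by omega)

/-- The probability that all elements of `D` are placed in `J` while no element of `C` is placed
in `I`. -/
lemma unifProb_subset_avoid_le [Nonempty (P ≃ E)] (I J : Finset P) (d : ℕ)
    (hd : d < Fintype.card P) (hdI : d ≤ #I) (D C : Finset E) (hD : #D ≤ d)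
    (hDC : Disjoint D C) :
    unifProb (fun σ : P ≃ E => (∀ e ∈ D, σ.symm e ∈ J) ∧ ∀ e ∈ C, σ.symm e ∉ I) ≤
      ((#J : ℝ) / (Fintype.card P - d)) ^ #D *
        (((Fintype.card P : ℝ) - #I) / (Fintype.card P - d)) ^ #C := by
  have hd' : (0 : ℝ) < Fintype.card P - d := by
    rw [sub_pos]; exact_mod_cast hd
  have hI : (0 : ℝ) ≤ Fintype.card P - #I := by
    rw [sub_nonneg]; exact_mod_cast card_le_univ I
  have hPE : Fintype.card P = Fintype.card E := Fintype.card_congr (Classical.arbitrary (P ≃ E))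
  induction C using Finset.induction_on with
  | empty =>
    simpa using unifProb_subset_le J d hd D hD
  | insert e C he ih =>
    rw [card_insert_of_notMem he, pow_succ, ← mul_assoc]
    have heD : e ∉ D := disjoint_right.1 hDC (mem_insert_self _ _)
    have hDC' : Disjoint D C := hDC.mono_right (subset_insert _ _)
    specialize ih hDC'
    have hcard : #D + #C + 1 ≤ Fintype.card P := by
      rw [hPE, ← card_union_of_disjoint hDC',
        ← card_insert_of_notMem (a := e) (s := D ∪ C) (by simp [he, heD])]
      exact card_le_univ _
    have h := unifProb_reveal_le
      (fun σ : P ≃ E => (∀ e ∈ D, σ.symm e ∈ J) ∧ ∀ e ∈ C, σ.symm e ∉ I) (D ∪ C) e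
      (by simp [he, heD])
      (fun σ σ' h hσ => ⟨fun x hx => h x (mem_union_left _ hx) ▸ hσ.1 x hx,
        fun x hx => h x (mem_union_right _ hx) ▸ hσ.2 x hx⟩) Iᶜ (Fintype.card P - #I - #C)
      (fun σ hσ => by
        have : Iᶜ \ (D ∪ C).image σ.symm ⊆ Iᶜ \ C.image σ.symm :=
          sdiff_subset_sdiff le_rfl (image_subset_image subset_union_right)
        refine (card_le_card this).trans (le_of_eq ?_)
        rw [card_sdiff_of_subset, card_image_of_injective _ σ.symm.injective, card_compl]
        intro x hx
        obtain ⟨y, hy, rfl⟩ := mem_image.1 hx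
        simpa using hσ.2 y hy)
    rw [card_union_of_disjoint hDC', ← Nat.sub_sub] at h
    have hpos : (0 : ℝ) < ((Fintype.card P - #D - #C : ℕ) : ℝ) := by
      exact_mod_cast (by omega : 0 < Fintype.card P - #D - #C)
    have hratio : ((Fintype.card P - #I - #C : ℕ) : ℝ) / ((Fintype.card P - #D - #C : ℕ) : ℝ) ≤
        ((Fintype.card P : ℝ) - #I) / (Fintype.card P - d) := by
      rw [div_le_div_iff₀ hpos hd']
      by_cases hc : #C ≤ Fintype.card P - #I
      · rw [Nat.cast_sub hc, Nat.cast_sub (card_le_univ I), Nat.cast_sub (by omega),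
          Nat.cast_sub (by omega)]
        have h1 : (#D : ℝ) ≤ d := by exact_mod_cast hD
        have h2 : (d : ℝ) ≤ #I := by exact_mod_cast hdI
        have h3 : (0 : ℝ) ≤ #C := by positivity
        nlinarith [mul_nonneg hI (sub_nonneg.2 h1), mul_nonneg h3 (sub_nonneg.2 h2)]
      · rw [Nat.sub_eq_zero_of_le (by omega)]
        simp only [Nat.cast_zero, zero_mul]
        positivity
    calc unifProb (fun σ : P ≃ E => (∀ e ∈ D, σ.symm e ∈ J) ∧ ∀ x ∈ insert e C, σ.symm x ∉ I)
        ≤ unifProb (fun σ : P ≃ E => ((∀ e ∈ D, σ.symm e ∈ J) ∧ ∀ e ∈ C, σ.symm e ∉ I) ∧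
            σ.symm e ∈ Iᶜ) :=
          unifProb_mono fun σ h => ⟨⟨h.1, fun x hx => h.2 x (mem_insert_of_mem hx)⟩,
            by simpa using h.2 e (mem_insert_self _ _)⟩
      _ ≤ unifProb (fun σ : P ≃ E => (∀ e ∈ D, σ.symm e ∈ J) ∧ ∀ e ∈ C, σ.symm e ∉ I) *
            ((Fintype.card P - #I - #C : ℕ) : ℝ) / ((Fintype.card P - #D - #C : ℕ) : ℝ) := by
          rw [le_div_iff₀ hpos]
          exact h
      _ ≤ _ := by
          rw [mul_div_assoc]
          exact mul_le_mul ih hratio (by positivity) ((unifProb_nonneg _).trans ih)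

lemma unifProb_avoid_eq [Nonempty (P ≃ E)] (I : Finset P) (C : Finset E)
    (hC : #C ≤ Fintype.card P - #I) :
    unifProb (fun σ : P ≃ E => ∀ e ∈ C, σ.symm e ∉ I) =
      ∏ j ∈ range #C, ((Fintype.card P : ℝ) - #I - j) / (Fintype.card P - j) := by
  induction C using Finset.induction_on with
  | empty => simp [unifProb_true]
  | insert e C he ih =>
    rw [card_insert_of_notMem he] at hC ⊢
    have hPI := card_le_univ I
    have h := unifProb_reveal_eq (fun σ : P ≃ E => ∀ e ∈ C, σ.symm e ∉ I) C e he
      (fun σ σ' h hσ x hx => h x hx ▸ hσ x hx) Iᶜ (Fintype.card P - #I - #C)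
      (fun σ hσ => by
        rw [card_sdiff_of_subset, card_image_of_injective _ σ.symm.injective, card_compl]
        intro x hx
        obtain ⟨y, hy, rfl⟩ := mem_image.1 hx
        simpa using hσ y hy)
    rw [Nat.cast_sub (by omega), Nat.cast_sub (by omega), Nat.cast_sub (by omega)] at h
    have hpos : (0 : ℝ) < Fintype.card P - #C := by
      rw [sub_pos]; exact_mod_cast (by omega : #C < Fintype.card P)
    have h0 : unifProb (fun σ : P ≃ E => ∀ x ∈ insert e C, σ.symm x ∉ I) =
        unifProb (fun σ : P ≃ E => (∀ e ∈ C, σ.symm e ∉ I) ∧ σ.symm e ∈ Iᶜ) := by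
      congr 1
      ext σ
      simp only [mem_insert, forall_eq_or_imp, mem_compl]
      exact and_comm
    rw [prod_range_succ, ← ih (by omega), h0, ← mul_div_assoc, eq_div_iff hpos.ne']
    exact h

end RandomBijection

section Deterministic

variable {V : Type*} [Fintype V]

lemma exists_median (p : V → ℝ) [Nonempty V] :
    ∃ c, Fintype.card V ≤ 3 * #{x | p x ≤ c} ∧ 3 * #{x | p x < c} < Fintype.card V := by
  classical
  let T : Finset V := {v | Fintype.card V ≤ 3 * #{x | p x ≤ p v}}
  have hT : T.Nonempty := by
    obtain ⟨v, -, hv⟩ := exists_max_image (univ : Finset V) p univ_nonempty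
    refine ⟨v, ?_⟩
    have : ({x | p x ≤ p v} : Finset V) = univ := by
      ext x; simpa using hv x (mem_univ x)
    simp only [T, mem_filter, mem_univ, true_and, this, card_univ]
    omega
  obtain ⟨v, hv, hmin⟩ := exists_min_image T p hT
  refine ⟨p v, by simpa [T] using hv, ?_⟩
  by_contra! hcon
  have hne : ({x | p x < p v} : Finset V).Nonempty := by
    rw [← card_pos]
    have := Fintype.card_pos (α := V)
    omega
  obtain ⟨w, hw, hmax⟩ := exists_max_image _ p hne
  have hw' : p w < p v := by simpa using hw
  have hsub : ({x | p x < p v} : Finset V) ⊆ ({x | p x ≤ p w} : Finset V) := by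
    intro x hx
    simpa using hmax x hx
  have hwT : w ∈ T := by
    simp only [T, mem_filter, mem_univ, true_and]
    have := card_le_card hsub
    omega
  exact absurd (hmin w hwT) (not_le.2 hw')

variable {G : SimpleGraph V}

lemma exists_large_level (hG : ∀ X Y : Finset V, Disjoint X Y → Fintype.card V ≤ 12 * #X →
      Fintype.card V ≤ 12 * #Y → ∃ x ∈ X, ∃ y ∈ Y, G.Adj x y)
    [Nonempty V] (p q : V → ℝ) (hadj : ∀ x y, G.Adj x y → p x = p y ∨ q x = q y) :
    (∃ c, Fintype.card V < 3 * #{x | p x = c}) ∨ ∃ c, Fintype.card V < 3 * #{x | q x = c} := by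
  classical
  by_contra! hcon
  obtain ⟨hp, hq⟩ := hcon
  obtain ⟨c, hc1, hc2⟩ := exists_median p
  obtain ⟨d, hd1, hd2⟩ := exists_median q
  have split : ∀ (r : V → ℝ) (t : ℝ), 
      #{x | r x ≤ t} = #{x | r x < t} + #{x | r x = t} := by
    intro r t
    rw [← card_union_of_disjoint]
    · congr 1; ext x; simp [le_iff_lt_or_eq]
    · rw [disjoint_filter]; intro x _ h1 h2; exact h1.ne h2
  have compl : ∀ (s : Finset V) (r : V → ℝ) (t : ℝ), 
      #{x ∈ s | r x ≤ t} + #{x ∈ s | t < r x} = #s := by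
    intro s r t
    simpa using card_filter_add_card_filter_not (s := s) (fun x => r x ≤ t)
  have e1 := split p c
  have e2 := split q d
  have e3 := compl univ p c
  have e4 := compl univ q d
  have e5 := compl {x | p x ≤ c} q d
  have e6 := compl {x | c < p x} q d
  have e7 := compl {x | q x ≤ d} p c
  have e8 := compl {x | d < q x} p c
  rw [filter_filter, filter_filter] at e5 e6 e7 e8
  simp only [and_comm (a := q _ ≤ d), and_comm (a := d < q _)] at e7 e8
  have hp := hp c
  have hq := hq d
  rw [card_univ] at e3 e4
  have h1 : ¬ (Fintype.card V ≤ 12 * #{x | p x ≤ c ∧ q x ≤ d} ∧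
      Fintype.card V ≤ 12 * #{x | c < p x ∧ d < q x}) := by
    rintro ⟨h1, h2⟩
    obtain ⟨x, hx, y, hy, h⟩ := hG _ _ (by
      rw [disjoint_filter]; intro x _ h1 h2; exact absurd h1.1 (not_le.2 h2.1)) h1 h2
    simp only [mem_filter, mem_univ, true_and] at hx hy
    rcases hadj x y h with h | h <;> linarith
  have h2 : ¬ (Fintype.card V ≤ 12 * #{x | p x ≤ c ∧ d < q x} ∧
      Fintype.card V ≤ 12 * #{x | c < p x ∧ q x ≤ d}) := by
    rintro ⟨h1, h2⟩
    obtain ⟨x, hx, y, hy, h⟩ := hG _ _ (by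
      rw [disjoint_filter]; intro x _ h1 h2; exact absurd h1.1 (not_le.2 h2.1)) h1 h2
    simp only [mem_filter, mem_univ, true_and] at hx hy
    rcases hadj x y h with h | h <;> linarith
  omega

lemma eq_of_large_level (hcard : 12 ≤ Fintype.card V)
    (hG : ∀ X Y : Finset V, Disjoint X Y → Fintype.card V ≤ 12 * #X →
      Fintype.card V ≤ 12 * #Y → ∃ x ∈ X, ∃ y ∈ Y, G.Adj x y)
    (hS : ∀ S : Finset V, S.Nonempty → 6 * #S < Fintype.card V →
      (∀ x ∈ S, ∀ y z, y ∉ S → z ∉ S → G.Adj x y → G.Adj x z → y = z) →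
      (∀ x ∈ S, ∃ y ∈ S, G.Adj x y) → False)
    (hdeg : ∀ v, ∃ x y, x ≠ y ∧ G.Adj v x ∧ G.Adj v y)
    (p q : V → ℝ) (hadj : ∀ x y, G.Adj x y → p x = p y ∨ q x = q y)
    (hinj : ∀ x y, p x = p y → q x = q y → x = y) (c : ℝ)
    (hc : Fintype.card V < 3 * #{x | p x = c}) (x : V) : p x = c := by
  classical
  set R : Finset V := {x | p x = c} with hR
  have memR : ∀ x, x ∈ R ↔ p x = c := by simp [hR]
  have huniq : ∀ x, x ∉ R → ∀ y z, y ∈ R → z ∈ R → G.Adj x y → G.Adj x z → y = z := by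
    intro x hx y z hy hz hxy hxz
    rw [memR] at hx hy hz
    have h1 : q x = q y := (hadj x y hxy).resolve_left fun h => hx (h.trans hy)
    have h2 : q x = q z := (hadj x z hxz).resolve_left fun h => hx (h.trans hz)
    exact hinj y z (hy.trans hz.symm) (h1.symm.trans h2)
  by_contra hx
  have hRc := card_add_card_compl R
  have hlarge : Fintype.card V ≤ 6 * #Rᶜ := by
    by_contra! hlt
    refine hS Rᶜ ⟨x, by simpa [memR] using hx⟩ hlt
      (fun x hx y z hy hz => huniq x (by simpa using hx) y z (by simpa using hy) (by simpa using hz))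
      fun v hv => ?_
    obtain ⟨y, z, hyz, h1, h2⟩ := hdeg v
    by_contra! hno
    exact hyz (huniq v (by simpa using hv) y z
      (by by_contra h; exact hno y (by simpa using h) h1)
      (by by_contra h; exact hno z (by simpa using h) h2) h1 h2)
  obtain ⟨R₁, hR₁, hcR₁⟩ := exists_subset_card_eq (s := R) (n := #R / 2) (by omega)
  have hR₂ : #(R \ R₁) = #R - #R / 2 := by rw [card_sdiff_of_subset hR₁, hcR₁]
  have hcov : Rᶜ ⊆ {x ∈ Rᶜ | ∀ y ∈ R₁, ¬ G.Adj x y} ∪ {x ∈ Rᶜ | ∀ y ∈ R \ R₁, ¬ G.Adj x y} := by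
    intro v hv
    simp only [mem_union, mem_filter, hv, true_and]
    by_contra! h
    obtain ⟨⟨y, hy, hvy⟩, z, hz, hvz⟩ := h
    rw [mem_sdiff] at hz
    exact hz.2 (huniq v (by simpa using hv) y z (hR₁ hy) hz.1 hvy hvz ▸ hy)
  have hsum := (card_le_card hcov).trans (card_union_le _ _)
  have hno : ∀ R' ⊆ R, Fintype.card V ≤ 12 * #R' →
      ¬ Fintype.card V ≤ 12 * #{x ∈ Rᶜ | ∀ y ∈ R', ¬ G.Adj x y} := by
    intro R' hR' h1 h2
    obtain ⟨x, hx, y, hy, h⟩ := hG _ R' (by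
      rw [disjoint_left]; intro x hx hx'; simp only [mem_filter, mem_compl] at hx
      exact hx.1 (hR' hx')) h2 h1
    exact (mem_filter.1 hx).2 y hy h
  have h1 := hno R₁ hR₁ (by omega)
  have h2 := hno (R \ R₁) sdiff_subset (by omega)
  omega

lemma globallyRigid_of_expansion (hcard : 12 ≤ Fintype.card V)
    (hG : ∀ X Y : Finset V, Disjoint X Y → Fintype.card V ≤ 12 * #X →
      Fintype.card V ≤ 12 * #Y → ∃ x ∈ X, ∃ y ∈ Y, G.Adj x y)
    (hS : ∀ S : Finset V, S.Nonempty → 6 * #S < Fintype.card V →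
      (∀ x ∈ S, ∀ y z, y ∉ S → z ∉ S → G.Adj x y → G.Adj x z → y = z) →
      (∀ x ∈ S, ∃ y ∈ S, G.Adj x y) → False)
    (hdeg : ∀ v, ∃ x y, x ≠ y ∧ G.Adj v x ∧ G.Adj v y) : GloballyRigid G := by
  classical
  intro f g hf _ hfg
  have : Nonempty V := Fintype.card_pos_iff.1 (by omega)
  have hadj : ∀ x y, G.Adj x y → f x - g x = f y - g y ∨ f x + g x = f y + g y := by
    intro x y h
    rcases abs_eq_abs.1 (hfg x y h) with h | h
    · left; linarith
    · right; linarith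
  have hinj : ∀ x y, f x - g x = f y - g y → f x + g x = f y + g y → x = y :=
    fun x y h1 h2 => hf (by linarith)
  rcases exists_large_level hG (fun x => f x - g x) (fun x => f x + g x) hadj with ⟨c, hc⟩ | ⟨c, hc⟩
  · intro x y
    have h := eq_of_large_level hcard hG hS hdeg _ _ hadj hinj c hc
    exact abs_eq_abs.2 (Or.inl (by linarith [h x, h y]))
  · intro x y
    have h := eq_of_large_level hcard hG hS hdeg _ _ (fun x y h => (hadj x y h).symm)
      (fun x y h1 h2 => hinj x y h2 h1) c hc
    exact abs_eq_abs.2 (Or.inr (by linarith [h x, h y]))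

end Deterministic

section EdgeSets

variable {V : Type*} [Fintype V] [DecidableEq V]

/-- The edges of the complete graph between `X` and `Y`. -/
def crossEdges (X Y : Finset V) : Finset (⊤ : SimpleGraph V).edgeSet :=
  {e | ∃ x ∈ X, ∃ y ∈ Y, (e : Sym2 V) = s(x, y)}

/-- The edges of the complete graph inside `S`. -/
def insideEdges (S : Finset V) : Finset (⊤ : SimpleGraph V).edgeSet :=
  {e | ∃ x ∈ S, ∃ y ∈ S, (e : Sym2 V) = s(x, y)}

lemma mem_crossEdges {X Y : Finset V} {e : (⊤ : SimpleGraph V).edgeSet} :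
    e ∈ crossEdges X Y ↔ ∃ x ∈ X, ∃ y ∈ Y, (e : Sym2 V) = s(x, y) := by
  simp [crossEdges]

lemma mem_insideEdges {S : Finset V} {e : (⊤ : SimpleGraph V).edgeSet} :
    e ∈ insideEdges S ↔ ∃ x ∈ S, ∃ y ∈ S, (e : Sym2 V) = s(x, y) := by
  simp [insideEdges]

lemma card_crossEdges {X Y : Finset V} (h : Disjoint X Y) : #(crossEdges X Y) = #X * #Y := by
  rw [← card_product, ← card_map (Function.Embedding.subtype _)]
  have : (crossEdges X Y).map (Function.Embedding.subtype _) =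
      (X ×ˢ Y).image fun p => s(p.1, p.2) := by
    ext e
    simp only [mem_map, mem_crossEdges, Function.Embedding.subtype_apply, mem_image, mem_product,
      Prod.exists]
    constructor
    · rintro ⟨e, ⟨x, hx, y, hy, he⟩, rfl⟩
      exact ⟨x, y, ⟨hx, hy⟩, he.symm⟩
    · rintro ⟨x, y, ⟨hx, hy⟩, rfl⟩
      exact ⟨⟨s(x, y), by simpa using disjoint_iff_ne.1 h x hx y hy⟩, ⟨x, hx, y, hy, rfl⟩, rfl⟩
  rw [this, card_image_of_injOn]
  rintro ⟨x, y⟩ hxy ⟨x', y'⟩ hxy' heq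
  simp only [coe_product, Set.mem_prod, mem_coe] at hxy hxy'
  rcases Sym2.eq_iff.1 heq with ⟨rfl, rfl⟩ | ⟨rfl, rfl⟩
  · rfl
  · exact absurd rfl (disjoint_iff_ne.1 h _ hxy.1 _ hxy'.2)

lemma card_insideEdges_le (S : Finset V) : #(insideEdges S) ≤ #S * #S := by
  rw [← card_product, ← card_map (Function.Embedding.subtype _)]
  refine (card_le_card (t := (S ×ˢ S).image fun p => s(p.1, p.2)) ?_).trans card_image_le
  intro e
  simp only [mem_map, mem_insideEdges, Function.Embedding.subtype_apply, mem_image, mem_product,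
    Prod.exists]
  rintro ⟨e, ⟨x, hx, y, hy, he⟩, rfl⟩
  exact ⟨x, y, ⟨hx, hy⟩, he.symm⟩

lemma disjoint_insideEdges_crossEdges (S : Finset V) :
    Disjoint (insideEdges S) (crossEdges S Sᶜ) := by
  rw [disjoint_left]
  intro e h1 h2
  obtain ⟨x, hx, y, hy, h⟩ := mem_insideEdges.1 h1
  obtain ⟨x', hx', y', hy', h'⟩ := mem_crossEdges.1 h2
  rw [mem_compl] at hy'
  rcases Sym2.eq_iff.1 (h.symm.trans h') with ⟨rfl, rfl⟩ | ⟨rfl, rfl⟩ <;> contradiction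

lemma card_two_stars {u v : V} (h : u ≠ v) :
    #(crossEdges {u} {u}ᶜ ∪ crossEdges {v} {u, v}ᶜ) =
      (Fintype.card V - 1) + (Fintype.card V - 2) := by
  rw [card_union_of_disjoint, card_crossEdges, card_crossEdges]
  · simp only [card_singleton, one_mul, card_compl, card_pair h]
  · rw [disjoint_singleton_left]; simp
  · rw [disjoint_singleton_left]; simp
  · rw [disjoint_left]
    intro e h1 h2
    obtain ⟨x, hx, y, hy, h⟩ := mem_crossEdges.1 h1
    obtain ⟨x', hx', y', hy', h'⟩ := mem_crossEdges.1 h2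
    simp only [mem_singleton, mem_compl, mem_insert, not_or] at hx hx' hy hy'
    rcases Sym2.eq_iff.1 (h.symm.trans h') with ⟨rfl, rfl⟩ | ⟨rfl, rfl⟩
    · subst hx; exact h.elim (by simp_all)
    · exact hy'.1 hx

lemma card_complete_edgeSet (n : ℕ) :
    Fintype.card (⊤ : SimpleGraph (Fin n)).edgeSet = n * (n - 1) / 2 := by
  rw [← SimpleGraph.edgeFinset_card, SimpleGraph.card_edgeFinset_top_eq_card_choose_two,
    Fintype.card_fin, Nat.choose_two_right]

end EdgeSets

section EdgeOrderings

variable {n : ℕ}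

/-- The first `m` positions. -/
def firstPositions (M m : ℕ) : Finset (Fin M) := {i | (i : ℕ) < m}

lemma mem_firstPositions {M m : ℕ} {i : Fin M} : i ∈ firstPositions M m ↔ (i : ℕ) < m := by
  simp [firstPositions]

lemma card_firstPositions {M m : ℕ} (h : m ≤ M) : #(firstPositions M m) = m := by
  simp [firstPositions, Fin.card_filter_val_lt, h]

lemma processGraph_adj {m : ℕ} {σ : Fin (n * (n - 1) / 2) ≃ (⊤ : SimpleGraph (Fin n)).edgeSet}
    {x y : Fin n} : (processGraph n m σ).Adj x y ↔
      ∃ e : (⊤ : SimpleGraph (Fin n)).edgeSet, (e : Sym2 (Fin n)) = s(x, y) ∧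
        σ.symm e ∈ firstPositions _ m := by
  simp only [processGraph, SimpleGraph.fromEdgeSet_adj, Set.mem_ofPred_eq, mem_firstPositions]
  constructor
  · rintro ⟨⟨i, hi, h⟩, -⟩
    exact ⟨σ i, h, by simpa using hi⟩
  · rintro ⟨e, he, hm⟩
    refine ⟨⟨σ.symm e, hm, by simpa using he⟩, ?_⟩
    have := e.2
    rw [he] at this
    simpa using this

lemma processGraph_mono {m m' : ℕ} (h : m ≤ m')
    (σ : Fin (n * (n - 1) / 2) ≃ (⊤ : SimpleGraph (Fin n)).edgeSet) :
    processGraph n m σ ≤ processGraph n m' σ := by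
  intro x y hxy
  obtain ⟨e, he, hm⟩ := processGraph_adj.1 hxy
  exact processGraph_adj.2 ⟨e, he, mem_firstPositions.2 ((mem_firstPositions.1 hm).trans_le h)⟩

/-- At some vertex, all edges but at most one are missing after `m` steps. -/
def HasLowDegree (n m : ℕ) (σ : Fin (n * (n - 1) / 2) ≃ (⊤ : SimpleGraph (Fin n)).edgeSet) :
    Prop :=
  ∃ v w : Fin n, ∀ e ∈ crossEdges {v} {v, w}ᶜ, σ.symm e ∉ firstPositions _ m

/-- Some vertex is isolated after `m` steps. -/
def HasIsolated (n m : ℕ) (σ : Fin (n * (n - 1) / 2) ≃ (⊤ : SimpleGraph (Fin n)).edgeSet) :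
    Prop :=
  ∃ v : Fin n, ∀ e ∈ crossEdges {v} {v}ᶜ, σ.symm e ∉ firstPositions _ m

/-- Two large disjoint vertex sets have no edge between them after `m` steps. -/
def HasLargeHole (n m : ℕ) (σ : Fin (n * (n - 1) / 2) ≃ (⊤ : SimpleGraph (Fin n)).edgeSet) :
    Prop :=
  ∃ X Y : Finset (Fin n), Disjoint X Y ∧ n ≤ 12 * #X ∧ n ≤ 12 * #Y ∧
    ∀ e ∈ crossEdges X Y, σ.symm e ∉ firstPositions _ m

/-- Some small vertex set `S` contains many edges after `m₂` steps while sending out few edges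
after `m₁` steps. -/
def HasTightSet (n m₁ m₂ : ℕ)
    (σ : Fin (n * (n - 1) / 2) ≃ (⊤ : SimpleGraph (Fin n)).edgeSet) : Prop :=
  ∃ S : Finset (Fin n), S.Nonempty ∧ 6 * #S < n ∧
    ∃ A ⊆ insideEdges S, #A = (#S + 1) / 2 ∧ ∃ B ⊆ crossEdges S Sᶜ, #B ≤ #S ∧
      (∀ e ∈ A ∪ B, σ.symm e ∈ firstPositions _ m₂) ∧
      ∀ e ∈ crossEdges S Sᶜ \ B, σ.symm e ∉ firstPositions _ m₁

variable {m₁ m₂ : ℕ} {σ : Fin (n * (n - 1) / 2) ≃ (⊤ : SimpleGraph (Fin n)).edgeSet}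

lemma two_le_degree_of_not_hasLowDegree {m : ℕ} (h : ¬ HasLowDegree n m σ) (v : Fin n) :
    2 ≤ ((processGraph n m σ).neighborSet v).ncard := by
  simp only [HasLowDegree, not_exists, not_forall, not_not] at h
  have key : ∀ w, ∃ y, y ≠ w ∧ (processGraph n m σ).Adj v y := by
    intro w
    obtain ⟨e, he, hm⟩ := h v w
    obtain ⟨x, hx, y, hy, hxy⟩ := mem_crossEdges.1 he
    rw [mem_singleton] at hx
    subst hx
    simp only [mem_compl, mem_insert, mem_singleton, not_or] at hy
    exact ⟨y, hy.2, processGraph_adj.2 ⟨e, hxy, hm⟩⟩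
  obtain ⟨y, -, hy⟩ := key v
  obtain ⟨z, hzy, hz⟩ := key y
  rw [← Set.ncard_pair hzy]
  exact Set.ncard_le_ncard (by rintro a (rfl | rfl) <;> assumption) (Set.toFinite _)

lemma hasTightSet_of_graph {G : SimpleGraph (Fin n)} (h1 : processGraph n m₁ σ ≤ G)
    (h2 : G ≤ processGraph n m₂ σ) (hm : m₁ ≤ m₂) (S : Finset (Fin n)) (hne : S.Nonempty)
    (hS : 6 * #S < n)
    (hout : ∀ x ∈ S, ∀ y z, y ∉ S → z ∉ S → G.Adj x y → G.Adj x z → y = z)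
    (hin : ∀ x ∈ S, ∃ y ∈ S, G.Adj x y) : HasTightSet n m₁ m₂ σ := by
  classical
  have hA : (#S + 1) / 2 ≤ #{e ∈ insideEdges S | σ.symm e ∈ firstPositions _ m₂} := by
    have hcov : S ⊆ ({e ∈ insideEdges S | σ.symm e ∈ firstPositions _ m₂} :
        Finset (⊤ : SimpleGraph (Fin n)).edgeSet).biUnion fun e => (e : Sym2 (Fin n)).toFinset := by
      intro x hx
      obtain ⟨y, hy, hxy⟩ := hin x hx
      obtain ⟨e, he, hm⟩ := processGraph_adj.1 (h2 hxy)
      exact mem_biUnion.2 ⟨e, mem_filter.2 ⟨mem_insideEdges.2 ⟨x, hx, y, hy, he⟩, hm⟩,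
        by simp [he]⟩
    have := (card_le_card hcov).trans (card_biUnion_le_card_mul _ _ 2 fun e _ => by
      rw [Sym2.card_toFinset]; split_ifs <;> omega)
    omega
  obtain ⟨A, hAsub, hAcard⟩ := exists_subset_card_eq hA
  refine ⟨S, hne, hS, A, hAsub.trans (filter_subset _ _), hAcard,
    {e ∈ crossEdges S Sᶜ | σ.symm e ∈ firstPositions _ m₁}, filter_subset _ _, ?_, ?_, ?_⟩
  · have hcov : ({e ∈ crossEdges S Sᶜ | σ.symm e ∈ firstPositions _ m₁} :
        Finset (⊤ : SimpleGraph (Fin n)).edgeSet) ⊆ S.biUnion fun x =>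
          {e ∈ crossEdges {x} Sᶜ | σ.symm e ∈ firstPositions _ m₁} := by
      intro e he
      rw [mem_filter] at he
      obtain ⟨x, hx, y, hy, hxy⟩ := mem_crossEdges.1 he.1
      exact mem_biUnion.2 ⟨x, hx, mem_filter.2
        ⟨mem_crossEdges.2 ⟨x, mem_singleton_self _, y, hy, hxy⟩, he.2⟩⟩
    refine (card_le_card hcov).trans ((card_biUnion_le_card_mul _ _ 1 fun x hx => ?_).trans
      (mul_one _).le)
    rw [card_le_one]
    intro e he e' he'
    rw [mem_filter] at he he'
    obtain ⟨x₁, hx₁, y, hy, hxy⟩ := mem_crossEdges.1 he.1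
    obtain ⟨x₂, hx₂, z, hz, hxz⟩ := mem_crossEdges.1 he'.1
    rw [mem_singleton] at hx₁ hx₂
    subst hx₁ hx₂
    have := hout _ hx y z (by simpa using hy) (by simpa using hz)
      (h1 (processGraph_adj.2 ⟨e, hxy, he.2⟩)) (h1 (processGraph_adj.2 ⟨e', hxz, he'.2⟩))
    subst this
    exact Subtype.ext (hxy.trans hxz.symm)
  · intro e he
    rcases mem_union.1 he with he | he
    · exact (mem_filter.1 (hAsub he)).2
    · have := mem_firstPositions.1 (mem_filter.1 he).2
      exact mem_firstPositions.2 (this.trans_le hm)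
  · intro e he hm
    rw [mem_sdiff, mem_filter] at he
    exact he.2 ⟨he.1, hm⟩

lemma globallyRigid_hittingTime (hn : 12 ≤ n) (hm : m₁ ≤ m₂) (hlow : ¬ HasLowDegree n m₂ σ)
    (hiso : HasIsolated n m₁ σ) (hhole : ¬ HasLargeHole n m₁ σ)
    (htight : ¬ HasTightSet n m₁ m₂ σ) :
    GloballyRigid (processGraph n (hittingTimeMinDeg2 n σ) σ) := by
  have hmem := two_le_degree_of_not_hasLowDegree hlow
  have hle : hittingTimeMinDeg2 n σ ≤ m₂ := Nat.sInf_le hmem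
  have hdeg : ∀ v, 2 ≤ ((processGraph n (hittingTimeMinDeg2 n σ) σ).neighborSet v).ncard :=
    Nat.sInf_mem (s := {m : ℕ | ∀ v : Fin n, 2 ≤ ((processGraph n m σ).neighborSet v).ncard})
      ⟨m₂, hmem⟩
  have hge : m₁ ≤ hittingTimeMinDeg2 n σ := by
    by_contra! hlt
    obtain ⟨v, hv⟩ := hiso
    have hempty : (processGraph n (hittingTimeMinDeg2 n σ) σ).neighborSet v = ∅ := by
      rw [Set.eq_empty_iff_forall_notMem]
      intro y hy
      rw [SimpleGraph.mem_neighborSet] at hy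
      have hy' := processGraph_mono hlt.le σ hy
      obtain ⟨e, he, hem⟩ := processGraph_adj.1 hy'
      exact hv e (mem_crossEdges.2 ⟨v, mem_singleton_self _, y, by
        simpa using hy.ne', he⟩) hem
    have := hdeg v
    rw [hempty, Set.ncard_empty] at this
    omega
  refine globallyRigid_of_expansion (by simpa using hn) ?_ ?_ ?_
  · intro X Y hXY hX hY
    rw [Fintype.card_fin] at hX hY
    simp only [HasLargeHole, not_exists, not_and, not_forall, not_not] at hhole
    obtain ⟨e, he, hem⟩ := hhole X Y hXY hX hY
    obtain ⟨x, hx, y, hy, hxy⟩ := mem_crossEdges.1 he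
    exact ⟨x, hx, y, hy, processGraph_mono hge σ (processGraph_adj.2 ⟨e, hxy, hem⟩)⟩
  · intro S hne hS hout hin
    exact htight (hasTightSet_of_graph (processGraph_mono hge σ) (processGraph_mono hle σ) hm S hne
      (by simpa using hS) hout hin)
  · intro v
    obtain ⟨x, y, hx, hy, hxy⟩ := (Set.one_lt_ncard_iff (Set.toFinite _)).1 (hdeg v)
    exact ⟨x, y, hxy, hx, hy⟩

end EdgeOrderings

section Bounds

variable {n : ℕ}

lemma cast_numEdges (n : ℕ) : ((n * (n - 1) / 2 : ℕ) : ℝ) = n * (n - 1) / 2 := by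
  rw [← Nat.choose_two_right, Nat.cast_choose_two]

lemma nonempty_ordering (n : ℕ) :
    Nonempty (Fin (n * (n - 1) / 2) ≃ (⊤ : SimpleGraph (Fin n)).edgeSet) :=
  Fintype.card_eq.1 (by rw [Fintype.card_fin, card_complete_edgeSet])

lemma unifProb_avoid_le {m : ℕ} (hm : m ≤ n * (n - 1) / 2) (hM : 0 < n * (n - 1) / 2)
    (C : Finset (⊤ : SimpleGraph (Fin n)).edgeSet) (c : ℝ) (hc : c ≤ #C) :
    unifProb (fun σ : Fin (n * (n - 1) / 2) ≃ (⊤ : SimpleGraph (Fin n)).edgeSet =>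
      ∀ e ∈ C, σ.symm e ∉ firstPositions _ m) ≤
      Real.exp (-(m * c / (n * (n - 1) / 2 : ℕ))) := by
  have := nonempty_ordering n
  have hM' : (0 : ℝ) < (n * (n - 1) / 2 : ℕ) := by exact_mod_cast hM
  have hm' : (m : ℝ) ≤ (n * (n - 1) / 2 : ℕ) := by exact_mod_cast hm
  have h := unifProb_subset_avoid_le (firstPositions (n * (n - 1) / 2) m) ∅ 0 (by simpa using hM)
    (Nat.zero_le _) ∅ C le_rfl (disjoint_empty_left C)
  simp only [notMem_empty, false_imp_iff, implies_true, true_and, card_empty, pow_zero, one_mul,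
    Fintype.card_fin, card_firstPositions hm, Nat.cast_zero, sub_zero] at h
  refine h.trans ?_
  generalize ((n * (n - 1) / 2 : ℕ) : ℝ) = M at *
  calc ((M - m) / M) ^ #C ≤ Real.exp (-(m / M)) ^ #C := by
        refine pow_le_pow_left₀ (div_nonneg (by linarith) hM'.le) ?_ _
        have := Real.add_one_le_exp (-(m / M))
        rw [sub_div, div_self hM'.ne']
        linarith
    _ = Real.exp (-(m * #C / M)) := by
        rw [← Real.exp_nat_mul]
        congr 1
        ring
    _ ≤ _ := by gcongr

lemma unifProb_hasLowDegree_le {m : ℕ} (hm : m ≤ n * (n - 1) / 2) (hM : 0 < n * (n - 1) / 2) :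
    unifProb (HasLowDegree n m) ≤
      (n : ℝ) ^ 2 * Real.exp (-(m * (n - 2 : ℝ) / (n * (n - 1) / 2 : ℕ))) := by
  calc unifProb (HasLowDegree n m)
      ≤ unifProb (fun σ : Fin (n * (n - 1) / 2) ≃ (⊤ : SimpleGraph (Fin n)).edgeSet =>
          ∃ p ∈ (univ : Finset (Fin n × Fin n)), ∀ e ∈ crossEdges {p.1} {p.1, p.2}ᶜ,
            σ.symm e ∉ firstPositions _ m) :=
        unifProb_mono fun σ ⟨v, w, h⟩ => ⟨(v, w), mem_univ _, h⟩
    _ ≤ ∑ p ∈ (univ : Finset (Fin n × Fin n)), _ := unifProb_exists_le _ _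
    _ ≤ ∑ _p ∈ (univ : Finset (Fin n × Fin n)),
          Real.exp (-(m * (n - 2 : ℝ) / (n * (n - 1) / 2 : ℕ))) := by
        refine sum_le_sum fun p _ => unifProb_avoid_le hm hM _ _ ?_
        rw [card_crossEdges (by simp), card_singleton, one_mul, card_compl, Fintype.card_fin]
        have h := card_le_two (a := p.1) (b := p.2)
        rw [sub_le_iff_le_add]
        exact_mod_cast (by omega : n ≤ n - #{p.1, p.2} + 2)
    _ = _ := by simp [sq]

lemma unifProb_hasLargeHole_le {m : ℕ} (hm : m ≤ n * (n - 1) / 2) (hM : 0 < n * (n - 1) / 2) :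
    unifProb (HasLargeHole n m) ≤
      (4 : ℝ) ^ n * Real.exp (-(m * (n ^ 2 / 144 : ℝ) / (n * (n - 1) / 2 : ℕ))) := by
  classical
  let F : Finset (Finset (Fin n) × Finset (Fin n)) :=
    {p | Disjoint p.1 p.2 ∧ n ≤ 12 * #p.1 ∧ n ≤ 12 * #p.2}
  calc unifProb (HasLargeHole n m)
      ≤ unifProb (fun σ : Fin (n * (n - 1) / 2) ≃ (⊤ : SimpleGraph (Fin n)).edgeSet =>
          ∃ p ∈ F, ∀ e ∈ crossEdges p.1 p.2, σ.symm e ∉ firstPositions _ m) :=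
        unifProb_mono fun σ ⟨X, Y, h1, h2, h3, h4⟩ => ⟨(X, Y), by simp [F, h1, h2, h3], h4⟩
    _ ≤ ∑ p ∈ F, _ := unifProb_exists_le _ _
    _ ≤ ∑ _p ∈ F, Real.exp (-(m * (n ^ 2 / 144 : ℝ) / (n * (n - 1) / 2 : ℕ))) := by
        refine sum_le_sum fun p hp => unifProb_avoid_le hm hM _ _ ?_
        simp only [F, mem_filter, mem_univ, true_and] at hp
        rw [card_crossEdges hp.1]
        have h1 : (n : ℝ) ≤ 12 * #p.1 := by exact_mod_cast hp.2.1
        have h2 : (n : ℝ) ≤ 12 * #p.2 := by exact_mod_cast hp.2.2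
        push_cast
        nlinarith [mul_le_mul h1 h2 (Nat.cast_nonneg n) (by positivity)]
    _ ≤ _ := by
        rw [sum_const, nsmul_eq_mul]
        gcongr
        have h : #F ≤ 4 ^ n := by
          refine (card_le_univ F).trans (le_of_eq ?_)
          simp only [Fintype.card_prod, Fintype.card_finset, Fintype.card_fin, ← mul_pow]
          norm_num
        exact_mod_cast h

lemma unifProb_hasIsolated_ge {m : ℕ} (hn : 2 ≤ n) (hm : m + 2 * n < n * (n - 1) / 2) (θ : ℝ)
    (hθ : (m : ℝ) / ((n * (n - 1) / 2 : ℕ) - n) ≤ θ) (hθ1 : θ < 1) :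
    (1 / (n * (1 - θ) ^ n) + 1 / (1 - θ))⁻¹ ≤ unifProb (HasIsolated n m) := by
  have := nonempty_ordering n
  set M : ℕ := n * (n - 1) / 2 with hMdef
  have hmM : (m : ℝ) + 2 * n < M := by exact_mod_cast hm
  have hm0 : (0 : ℝ) ≤ m := Nat.cast_nonneg m
  have hn0 : (0 : ℝ) < n := by exact_mod_cast (by omega : 0 < n)
  let x : ℕ → ℝ := fun j => ((M : ℝ) - m - j) / (M - j)
  have hx : ∀ j ≤ n, 1 - θ ≤ x j := by
    intro j hj
    have hj' : (j : ℝ) ≤ n := by exact_mod_cast hj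
    have hpos : (0 : ℝ) < M - j := by linarith
    have h1 : x j = 1 - m / (M - j) := by
      simp only [x]; field_simp; ring
    rw [h1]
    have : (m : ℝ) / (M - j) ≤ m / (M - n) :=
      div_le_div_of_nonneg_left hm0 (by linarith) (by linarith)
    linarith
  have hxpos : ∀ j ≤ 2 * n, 0 < x j := by
    intro j hj
    have hj' : (j : ℝ) ≤ 2 * n := by exact_mod_cast hj
    exact div_pos (by linarith) (by linarith)
  have hanti : ∀ i j, i ≤ j → j ≤ 2 * n → x j ≤ x i := by
    intro i j hij hj
    have hj' : (j : ℝ) ≤ 2 * n := by exact_mod_cast hj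
    have hij' : (i : ℝ) ≤ j := by exact_mod_cast hij
    simp only [x]
    rw [div_le_div_iff₀ (by linarith) (by linarith)]
    nlinarith
  have havoid : ∀ C : Finset (⊤ : SimpleGraph (Fin n)).edgeSet, #C ≤ 2 * n →
      unifProb (fun σ : Fin M ≃ (⊤ : SimpleGraph (Fin n)).edgeSet =>
        ∀ e ∈ C, σ.symm e ∉ firstPositions _ m) = ∏ j ∈ range #C, x j := by
    intro C hC
    rw [unifProb_avoid_eq _ _ (by
      rw [Fintype.card_fin, card_firstPositions (by omega)]; omega)]
    rw [Fintype.card_fin, card_firstPositions (by omega)]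
  set a : ℝ := ∏ j ∈ range (n - 1), x j with ha
  set b : ℝ := ∏ j ∈ range ((n - 1) + (n - 2)), x j with hb
  have hapos : 0 < a := prod_pos fun j hj => hxpos j (by rw [mem_range] at hj; omega)
  have hbpos : 0 < b := prod_pos fun j hj => hxpos j (by rw [mem_range] at hj; omega)
  have hθpos : 0 < 1 - θ := by linarith
  have hθ0 : 0 ≤ θ := (div_nonneg hm0 (by linarith)).trans hθ
  have hage : (1 - θ) ^ n ≤ a := by
    calc (1 - θ) ^ n ≤ (1 - θ) ^ (n - 1) :=
          pow_le_pow_of_le_one hθpos.le (by linarith) (by omega)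
      _ = ∏ j ∈ range (n - 1), (1 - θ) := by simp
      _ ≤ a := prod_le_prod (fun _ _ => hθpos.le) fun j hj => hx j (by
          rw [mem_range] at hj; omega)
  have hba : b * (1 - θ) ≤ a ^ 2 := by
    have h1 : a = (∏ j ∈ range (n - 2), x j) * x (n - 2) := by
      rw [ha, ← prod_range_succ]
      congr 2
      omega
    have h2 : b ≤ a * ∏ j ∈ range (n - 2), x j := by
      rw [hb, prod_range_add]
      refine mul_le_mul_of_nonneg_left (prod_le_prod (fun j hj => ?_) fun j hj => ?_) hapos.le
      · rw [mem_range] at hj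
        exact (hxpos _ (by omega)).le
      · rw [mem_range] at hj
        exact hanti _ _ (by omega) (by omega)
    calc b * (1 - θ) ≤ (a * ∏ j ∈ range (n - 2), x j) * x (n - 2) := by
          refine mul_le_mul h2 (hx _ (by omega)) hθpos.le (hbpos.le.trans h2)
      _ = a ^ 2 := by rw [mul_assoc, ← h1, sq]
  have hsm := second_moment (Ω := Fin M ≃ (⊤ : SimpleGraph (Fin n)).edgeSet)
    (fun v : Fin n => fun σ => ∀ e ∈ crossEdges {v} {v}ᶜ, σ.symm e ∉ firstPositions _ m) a b
    (fun v => by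
      have hc : #(crossEdges {v} {v}ᶜ) = n - 1 := by
        rw [card_crossEdges (by simp), card_singleton, one_mul, card_compl, card_singleton,
          Fintype.card_fin]
      rw [havoid _ (by omega), hc])
    (fun u v huv => by
      have hc := card_two_stars huv
      rw [Fintype.card_fin] at hc
      rw [hb, ← hc, ← havoid _ (by omega)]
      refine unifProb_mono fun σ h e he => ?_
      rcases mem_union.1 he with he | he
      · exact h.1 e he
      · refine h.2 e ?_
        obtain ⟨x, hx, y, hy, hxy⟩ := mem_crossEdges.1 he
        exact mem_crossEdges.2 ⟨x, hx, y, by simp at hy ⊢; tauto, hxy⟩) hbpos.le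
  rw [Fintype.card_fin] at hsm
  change _ ≤ unifProb (HasIsolated n m) * _ at hsm
  set p := unifProb (HasIsolated n m) with hp
  have hp0 : 0 ≤ p := unifProb_nonneg _
  set t := (1 - θ) ^ n with ht
  have htpos : 0 < t := pow_pos hθpos n
  have hu : 1 ≤ p * (1 / (n * t) + 1 / (1 - θ)) := by
    have h1 : (n * a + n ^ 2 * b : ℝ) ≤ (n * a) ^ 2 * (1 / (n * t) + 1 / (1 - θ)) := by
      have e1 : (n * a : ℝ) ≤ (n * a) ^ 2 * (1 / (n * t)) := by
        rw [mul_one_div, le_div_iff₀ (by positivity)]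
        have : n * t ≤ n * a := mul_le_mul_of_nonneg_left hage hn0.le
        nlinarith [mul_le_mul_of_nonneg_left this (by positivity : 0 ≤ n * a)]
      have e2 : (n ^ 2 * b : ℝ) ≤ (n * a) ^ 2 * (1 / (1 - θ)) := by
        rw [mul_one_div, le_div_iff₀ hθpos]
        nlinarith [mul_le_mul_of_nonneg_left hba (by positivity : (0 : ℝ) ≤ n ^ 2)]
      linarith
    have h2 : (n * a : ℝ) ^ 2 * 1 ≤ (n * a) ^ 2 * (p * (1 / (n * t) + 1 / (1 - θ))) := by
      have := mul_le_mul_of_nonneg_left h1 hp0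
      linarith
    exact le_of_mul_le_mul_left h2 (by positivity)
  rw [inv_le_iff_one_le_mul₀ (by positivity)]
  exact hu

end Bounds

section TightSets

variable {n : ℕ}

lemma sum_small_subsets_le {α : Type*} [DecidableEq α] (T : Finset α) (s : ℕ) (q y : ℝ)
    (hq : 0 ≤ q) (hy : 1 ≤ y) (hT : #T * q ≤ s * y) :
    ∑ B ∈ T.powerset with #B ≤ s, q ^ #B ≤ (Real.exp 1 * y) ^ s := by
  have hy0 : 0 < y := by linarith
  calc ∑ B ∈ T.powerset with #B ≤ s, q ^ #B
      ≤ ∑ B ∈ T.powerset with #B ≤ s, y ^ s * (q / y) ^ #B := by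
        refine sum_le_sum fun B hB => ?_
        rw [mem_filter] at hB
        rw [div_pow, mul_div_assoc', le_div_iff₀ (by positivity), mul_comm]
        exact mul_le_mul_of_nonneg_right (pow_le_pow_right₀ hy hB.2) (by positivity)
    _ ≤ ∑ B ∈ T.powerset, y ^ s * (q / y) ^ #B :=
        sum_le_sum_of_subset_of_nonneg (filter_subset _ _) fun _ _ _ => by positivity
    _ = y ^ s * (1 + q / y) ^ #T := by
        rw [← mul_sum]
        congr 1
        have := prod_one_add (f := fun _ : α => q / y) T
        simp only [prod_const] at this
        exact this.symm
    _ ≤ y ^ s * Real.exp (q / y) ^ #T := by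
        gcongr
        linarith [Real.add_one_le_exp (q / y)]
    _ ≤ y ^ s * Real.exp 1 ^ s := by
        gcongr
        rw [← Real.exp_nat_mul, ← Real.exp_nat_mul, Real.exp_le_exp, mul_one, mul_div_assoc',
          div_le_iff₀ hy0]
        exact hT
    _ = _ := by rw [← mul_pow, mul_comm]

lemma choose_mul_pow_le (N s k : ℕ) (q : ℝ) (hq : 0 ≤ q) (hN : N ≤ s * s) :
    (N.choose k : ℝ) * q ^ k ≤ (q * s) ^ k * Real.exp s := by
  have hk : (0 : ℝ) < k.factorial := by exact_mod_cast Nat.factorial_pos k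
  have hN' : (N : ℝ) ≤ s * s := by exact_mod_cast hN
  calc (N.choose k : ℝ) * q ^ k ≤ ((N : ℝ) ^ k / k.factorial) * q ^ k := by
        gcongr
        exact Nat.choose_le_pow_div k N
    _ ≤ ((s * s : ℝ) ^ k / k.factorial) * q ^ k := by gcongr
    _ = (q * s) ^ k * ((s : ℝ) ^ k / k.factorial) := by
        rw [mul_pow, mul_pow]; ring
    _ ≤ _ := by
        gcongr
        exact Real.pow_div_factorial_le_exp _ (Nat.cast_nonneg s) k

lemma choose_mul_div_pow_le {s : ℕ} (hs : 0 < s) (hsn : s ≤ n) :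
    (n.choose s : ℝ) * ((s : ℝ) / n) ^ ((s + 1) / 2) ≤ (Real.exp 1 * √n) ^ s := by
  have hs0 : (0 : ℝ) < s := by exact_mod_cast hs
  have hs1 : (1 : ℝ) ≤ s := by exact_mod_cast hs
  have hsn' : (s : ℝ) ≤ n := by exact_mod_cast hsn
  have hn0 : (0 : ℝ) < n := by linarith
  have hfac : (0 : ℝ) < s.factorial := by exact_mod_cast Nat.factorial_pos s
  have hsum : s = (s + 1) / 2 + s / 2 := by omega
  calc (n.choose s : ℝ) * ((s : ℝ) / n) ^ ((s + 1) / 2)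
      ≤ ((n : ℝ) ^ s / s.factorial) * ((s : ℝ) / n) ^ ((s + 1) / 2) := by
        gcongr
        exact Nat.choose_le_pow_div s n
    _ = ((s : ℝ) ^ s / s.factorial) * ((n / s : ℝ) ^ s * ((s : ℝ) / n) ^ ((s + 1) / 2)) := by
        rw [div_pow (n : ℝ)]; field_simp
    _ = ((s : ℝ) ^ s / s.factorial) * (n / s : ℝ) ^ (s / 2) := by
        congr 1
        have h1 : (n / s : ℝ) ^ s = (n / s : ℝ) ^ ((s + 1) / 2) * (n / s : ℝ) ^ (s / 2) := by
          rw [← pow_add, ← hsum]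
        rw [h1, mul_right_comm, ← mul_pow]
        have : (n / s : ℝ) * (s / n) = 1 := by field_simp
        rw [this, one_pow, one_mul]
    _ ≤ Real.exp s * (√n) ^ s := by
        gcongr
        · exact Real.pow_div_factorial_le_exp _ hs0.le s
        · calc (n / s : ℝ) ^ (s / 2) ≤ (n : ℝ) ^ (s / 2) := by
                gcongr
                exact div_le_self hn0.le hs1
            _ = (√n) ^ (2 * (s / 2)) := by rw [pow_mul, Real.sq_sqrt hn0.le]
            _ ≤ (√n) ^ s := pow_le_pow_right₀ (Real.one_le_sqrt.2 (by linarith)) (by omega)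
    _ = _ := by rw [mul_pow, ← Real.exp_nat_mul, mul_one]

/-- The contribution of a single set `S` to the event `HasTightSet`. -/
lemma unifProb_tight_le {m₁ m₂ : ℕ} (h₁ : m₁ ≤ n * (n - 1) / 2) (h₂ : m₂ ≤ n * (n - 1) / 2)
    (hn₁ : n ≤ m₁) (hnM : n < n * (n - 1) / 2) (y η : ℝ) (hy : 1 ≤ y)
    (hq : (m₂ : ℝ) / ((n * (n - 1) / 2 : ℕ) - n) ≤ y / n)
    (hη : ∀ s, 6 * s < n →
      ((((n * (n - 1) / 2 : ℕ) : ℝ) - m₁) / ((n * (n - 1) / 2 : ℕ) - n)) ^ (n - s - 1) ≤ η)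
    (S : Finset (Fin n)) (hne : S.Nonempty) (hS : 6 * #S < n) :
    unifProb (fun σ : Fin (n * (n - 1) / 2) ≃ (⊤ : SimpleGraph (Fin n)).edgeSet =>
      ∃ A ⊆ insideEdges S, #A = (#S + 1) / 2 ∧ ∃ B ⊆ crossEdges S Sᶜ, #B ≤ #S ∧
      (∀ e ∈ A ∪ B, σ.symm e ∈ firstPositions _ m₂) ∧
      ∀ e ∈ crossEdges S Sᶜ \ B, σ.symm e ∉ firstPositions _ m₁) ≤
      ((#S : ℝ) / n) ^ ((#S + 1) / 2) * (Real.exp 2 * y ^ 2 * η) ^ #S := by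
  classical
  have := nonempty_ordering n
  set M : ℕ := n * (n - 1) / 2 with hMdef
  set s := #S with hs
  set k := (s + 1) / 2 with hk
  have hs0 : 0 < s := card_pos.2 hne
  have hn0 : (0 : ℝ) < n := by exact_mod_cast (by omega : 0 < n)
  have hM' : (0 : ℝ) < (M : ℝ) - n := by
    rw [sub_pos]; exact_mod_cast hnM
  have h₁' : (m₁ : ℝ) ≤ M := by exact_mod_cast h₁
  have hn₁' : (n : ℝ) ≤ m₁ := by exact_mod_cast hn₁
  set q : ℝ := y / n with hqdef
  set ρ : ℝ := ((M : ℝ) - m₁) / (M - n) with hρ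
  have hq0 : 0 ≤ q := by positivity
  have hρ0 : 0 ≤ ρ := div_nonneg (by linarith) hM'.le
  have hρ1 : ρ ≤ 1 := by
    rw [hρ, div_le_one hM']; linarith
  have hη0 : 0 ≤ η := (pow_nonneg hρ0 _).trans (hη s hS)
  set T := crossEdges S Sᶜ with hT
  have hTcard : #T = s * (n - s) := by
    rw [hT, card_crossEdges disjoint_compl_right, card_compl, Fintype.card_fin]
  let F := (powersetCard k (insideEdges S)) ×ˢ {B ∈ T.powerset | #B ≤ s}
  calc _ ≤ unifProb (fun σ : Fin M ≃ (⊤ : SimpleGraph (Fin n)).edgeSet =>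
        ∃ p ∈ F, (∀ e ∈ p.1 ∪ p.2, σ.symm e ∈ firstPositions _ m₂) ∧
          ∀ e ∈ T \ p.2, σ.symm e ∉ firstPositions _ m₁) := by
        refine unifProb_mono ?_
        rintro σ ⟨A, hA, hAk, B, hB, hBs, h⟩
        exact ⟨(A, B), by simp [F, mem_powersetCard, hA, hAk, hB, hBs], h⟩
    _ ≤ ∑ p ∈ F, _ := unifProb_exists_le _ _
    _ ≤ ∑ p ∈ F, q ^ #p.1 * q ^ #p.2 * η ^ s := by
        refine sum_le_sum fun p hp => ?_
        simp only [F, mem_product, mem_powersetCard, mem_filter, mem_powerset] at hp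
        obtain ⟨⟨hA, hAk⟩, hB, hBs⟩ := hp
        have hdisj : Disjoint p.1 p.2 :=
          (disjoint_insideEdges_crossEdges S).mono hA hB
        have hcard : #(p.1 ∪ p.2) = #p.1 + #p.2 := card_union_of_disjoint hdisj
        have h := unifProb_subset_avoid_le (firstPositions M m₁) (firstPositions M m₂) n
          (by simpa using hnM) (by rwa [card_firstPositions h₁]) (p.1 ∪ p.2) (T \ p.2)
          (by rw [hcard]; omega)
          (disjoint_union_left.2 ⟨((disjoint_insideEdges_crossEdges S).mono hA sdiff_subset),
            disjoint_sdiff⟩)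
        rw [Fintype.card_fin, card_firstPositions h₁, card_firstPositions h₂, hcard] at h
        refine h.trans ?_
        rw [← pow_add]
        refine mul_le_mul (pow_le_pow_left₀ (by positivity) hq _) ?_ (by positivity)
          (by positivity)
        have hle : (n - s - 1) * s ≤ #(T \ p.2) := by
          rw [card_sdiff_of_subset hB, hTcard]
          have : (n - s - 1) * s = s * (n - s) - s := by
            rw [Nat.sub_mul, one_mul, mul_comm]
          omega
        calc ρ ^ #(T \ p.2) ≤ ρ ^ ((n - s - 1) * s) := pow_le_pow_of_le_one hρ0 hρ1 hle
          _ = (ρ ^ (n - s - 1)) ^ s := pow_mul _ _ _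
          _ ≤ η ^ s := pow_le_pow_left₀ (pow_nonneg hρ0 _) (hη s hS) _
    _ = (∑ A ∈ powersetCard k (insideEdges S), q ^ #A) *
          (∑ B ∈ T.powerset with #B ≤ s, q ^ #B) * η ^ s := by
        rw [sum_mul_sum, ← sum_product', sum_mul]
    _ ≤ ((q * s) ^ k * Real.exp s) * (Real.exp 1 * y) ^ s * η ^ s := by
        gcongr
        · rw [sum_congr rfl (g := fun _ => q ^ k) fun A hA => by rw [(mem_powersetCard.1 hA).2],
            sum_const, card_powersetCard, nsmul_eq_mul]
          exact choose_mul_pow_le _ _ _ _ hq0 (card_insideEdges_le S)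
        · refine sum_small_subsets_le T s q y hq0 hy ?_
          rw [hTcard, hqdef, Nat.cast_mul, mul_assoc]
          gcongr
          rw [mul_div_assoc', div_le_iff₀ hn0, mul_comm]
          gcongr
          exact Nat.sub_le _ _
    _ = ((s : ℝ) / n) ^ k * (y ^ k * (Real.exp 2 * y * η) ^ s) := by
        have h2 : Real.exp 2 = Real.exp 1 * Real.exp 1 := by rw [← Real.exp_add]; norm_num
        have h3 : Real.exp s = Real.exp 1 ^ s := by rw [← Real.exp_nat_mul, mul_one]
        have h4 : q * s = (s : ℝ) / n * y := by rw [hqdef]; ring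
        rw [h2, h3, h4]
        simp only [mul_pow]
        ring
    _ ≤ ((s : ℝ) / n) ^ k * (y ^ s * (Real.exp 2 * y * η) ^ s) := by
        gcongr
        omega
    _ = _ := by
        rw [← mul_pow]
        congr 2
        ring

lemma unifProb_hasTightSet_le {m₁ m₂ : ℕ} (h₁ : m₁ ≤ n * (n - 1) / 2)
    (h₂ : m₂ ≤ n * (n - 1) / 2) (hn₁ : n ≤ m₁) (hnM : n < n * (n - 1) / 2) (y η : ℝ)
    (hy : 1 ≤ y) (hη0 : 0 ≤ η) (hq : (m₂ : ℝ) / ((n * (n - 1) / 2 : ℕ) - n) ≤ y / n)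
    (hη : ∀ s, 6 * s < n →
      ((((n * (n - 1) / 2 : ℕ) : ℝ) - m₁) / ((n * (n - 1) / 2 : ℕ) - n)) ^ (n - s - 1) ≤ η)
    (hx : Real.exp 3 * y ^ 2 * η * √n ≤ 1 / 2) :
    unifProb (HasTightSet n m₁ m₂) ≤ 2 * (Real.exp 3 * y ^ 2 * η * √n) := by
  classical
  set x := Real.exp 3 * y ^ 2 * η * √n with hxdef
  have hx0 : 0 ≤ x := by positivity
  let F : Finset (Finset (Fin n)) := {S | S.Nonempty ∧ 6 * #S < n}
  let w : ℕ → ℝ := fun s =>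
    if s = 0 then 0 else ((s : ℝ) / n) ^ ((s + 1) / 2) * (Real.exp 2 * y ^ 2 * η) ^ s
  have hw0 : ∀ s, 0 ≤ w s := by
    intro s
    simp only [w]
    split_ifs <;> positivity
  calc unifProb (HasTightSet n m₁ m₂)
      ≤ unifProb (fun σ : Fin (n * (n - 1) / 2) ≃ (⊤ : SimpleGraph (Fin n)).edgeSet =>
        ∃ S ∈ F, ∃ A ⊆ insideEdges S, #A = (#S + 1) / 2 ∧ ∃ B ⊆ crossEdges S Sᶜ, #B ≤ #S ∧
          (∀ e ∈ A ∪ B, σ.symm e ∈ firstPositions _ m₂) ∧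
          ∀ e ∈ crossEdges S Sᶜ \ B, σ.symm e ∉ firstPositions _ m₁) := by
        refine unifProb_mono ?_
        rintro σ ⟨S, hne, hS, h⟩
        exact ⟨S, by simp [F, hne, hS], h⟩
    _ ≤ ∑ S ∈ F, _ := unifProb_exists_le _ _
    _ ≤ ∑ S ∈ F, w #S := by
        refine sum_le_sum fun S hS => ?_
        simp only [F, mem_filter, mem_univ, true_and] at hS
        simp only [w, if_neg (card_pos.2 hS.1).ne']
        exact unifProb_tight_le h₁ h₂ hn₁ hnM y η hy hq hη S hS.1 hS.2
    _ ≤ ∑ S : Finset (Fin n), w #S :=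
        sum_le_univ_sum_of_nonneg fun S => hw0 _
    _ = ∑ s ∈ range (n + 1), (n.choose s : ℝ) * w s := by
        rw [← powerset_univ, sum_powerset_apply_card]
        simp
    _ = ∑ s ∈ range n, (n.choose (s + 1) : ℝ) * w (s + 1) := by
        rw [sum_range_succ']
        simp [w]
    _ ≤ ∑ s ∈ range n, x * x ^ s := by
        refine sum_le_sum fun s hs => ?_
        rw [mem_range] at hs
        simp only [w, if_neg (Nat.succ_ne_zero s)]
        rw [← mul_assoc, ← pow_succ']
        calc _ ≤ (Real.exp 1 * √n) ^ (s + 1) * (Real.exp 2 * y ^ 2 * η) ^ (s + 1) := by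
              refine mul_le_mul_of_nonneg_right ?_ (by positivity)
              exact choose_mul_div_pow_le (Nat.succ_pos s) hs
          _ = x ^ (s + 1) := by
              have h3 : Real.exp 3 = Real.exp 1 * Real.exp 2 := by rw [← Real.exp_add]; norm_num
              rw [← mul_pow, hxdef, h3]
              congr 1
              ring
    _ = x * ∑ s ∈ range n, x ^ s := by rw [mul_sum]
    _ ≤ x * (1 - x)⁻¹ := by
        gcongr
        rw [← tsum_geometric_of_lt_one hx0 (by linarith)]
        exact (summable_geometric_of_lt_one hx0 (by linarith)).sum_le_tsum _ fun _ _ => by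
          positivity
    _ ≤ x * 2 := by
        gcongr
        rw [inv_le_comm₀ (by linarith) (by norm_num)]
        linarith
    _ = 2 * x := mul_comm _ _

end TightSets

section Main

open Filter Topology

lemma exp_neg_le_one_sub_pow {θ : ℝ} (h0 : 0 ≤ θ) (h1 : θ ≤ 1 / 1000) (n : ℕ) :
    Real.exp (-(1.01 * θ * n)) ≤ (1 - θ) ^ n := by
  have h : Real.exp (-(1.01 * θ)) ≤ 1 - θ := by
    rw [Real.exp_neg, inv_le_comm₀ (Real.exp_pos _) (by linarith)]
    refine le_trans ?_ (Real.add_one_le_exp _)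
    rw [inv_le_iff_one_le_mul₀ (by linarith)]
    nlinarith
  calc Real.exp (-(1.01 * θ * n)) = Real.exp (-(1.01 * θ)) ^ n := by
        rw [← Real.exp_nat_mul]; congr 1; ring
    _ ≤ _ := pow_le_pow_left₀ (Real.exp_pos _).le h n

lemma eventually_exp_bounds {ε : ℝ} (hε : 0 < ε) : ∀ᶠ n : ℕ in atTop,
    500 ≤ Real.log n ∧ Real.log n ≤ ε * n ∧ Real.exp (-Real.log n) ≤ ε ∧
      Real.exp (-(0.05 * Real.log n)) ≤ ε ∧
      Real.exp 3 * (5 * Real.log n) ^ 2 * Real.exp (-(0.7 * Real.log n)) * √n ≤ ε := by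
  have hlog : Tendsto (fun n : ℕ => Real.log n) atTop atTop :=
    Real.tendsto_log_atTop.comp tendsto_natCast_atTop_atTop
  have h2 : ∀ᶠ n : ℕ in atTop, Real.log n ≤ ε * n := by
    have := tendsto_natCast_atTop_atTop.eventually
      ((Real.isLittleO_log_id_atTop).bound hε)
    filter_upwards [this] with n hn
    simpa using (le_abs_self _).trans hn
  have hexp : ∀ c : ℝ, 0 < c → ∀ᶠ x : ℝ in atTop, Real.exp (-(c * x)) ≤ ε := by
    intro c hc
    have : Tendsto (fun x : ℝ => Real.exp (-(c * x))) atTop (𝓝 0) :=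
      Real.tendsto_exp_neg_atTop_nhds_zero.comp (tendsto_id.const_mul_atTop hc)
    exact this.eventually_le_const hε
  have hpoly : ∀ᶠ x : ℝ in atTop, Real.exp 3 * (5 * x) ^ 2 * Real.exp (-(0.2 * x)) ≤ ε := by
    have h1 : Tendsto (fun x : ℝ => (0.2 * x) ^ 2 * Real.exp (-(0.2 * x))) atTop (𝓝 0) :=
      (Real.tendsto_pow_mul_exp_neg_atTop_nhds_zero 2).comp
        (tendsto_id.const_mul_atTop (by norm_num : (0 : ℝ) < 0.2))
    have h3 := h1.const_mul (Real.exp 3 * 625)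
    rw [mul_zero] at h3
    filter_upwards [h3.eventually_le_const hε] with x hx
    refine le_trans (le_of_eq ?_) hx
    ring
  filter_upwards [hlog.eventually_ge_atTop 500, h2, hlog.eventually (hexp 1 one_pos),
    hlog.eventually (hexp 0.05 (by norm_num)), hlog.eventually hpoly, eventually_gt_atTop 0]
    with n a1 a2 a3 a4 a5 hn
  refine ⟨a1, a2, by simpa using a3, a4, le_trans (le_of_eq ?_) a5⟩
  have hn0 : (0 : ℝ) < n := by exact_mod_cast hn
  have hsqrt : √(n : ℝ) = Real.exp (0.5 * Real.log n) := by
    rw [Real.sqrt_eq_rpow, Real.rpow_def_of_pos hn0]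
    congr 1
    ring
  rw [hsqrt, mul_assoc, ← Real.exp_add]
  congr 2
  ring

set_option maxHeartbeats 1000000 in
lemma unifProb_failure_le {n : ℕ} {ε L x : ℝ} (hx : x = n) (hexpL : Real.exp L = x)
    (hε1 : ε ≤ 1 / 1000) (hL : 500 ≤ L) (hLn : L ≤ ε * x) (he1 : Real.exp (-L) ≤ ε)
    (he2 : Real.exp (-(0.05 * L)) ≤ ε)
    (he3 : Real.exp 3 * (5 * L) ^ 2 * Real.exp (-(0.7 * L)) * √x ≤ ε) :
    12 ≤ n ∧ ∃ m₁ m₂, m₁ ≤ m₂ ∧ unifProb (fun σ => HasLowDegree n m₂ σ ∨ ¬ HasIsolated n m₁ σ ∨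
      HasLargeHole n m₁ σ ∨ HasTightSet n m₁ m₂ σ) ≤ 7 * ε := by
  have := nonempty_ordering n
  have hM : ((n * (n - 1) / 2 : ℕ) : ℝ) = x * (x - 1) / 2 := by rw [hx]; exact cast_numEdges n
  have hε0 : 0 < ε := (Real.exp_pos _).trans_le he1
  have hn0 : 0 ≤ x := by rw [← hexpL]; exact (Real.exp_pos _).le
  have hLn' : 1000 * L ≤ x := by linarith [mul_le_mul_of_nonneg_right hε1 hn0]
  have hxn : (500000 : ℝ) ≤ x := by linarith
  have hxL : 500 * x ≤ x * L := by linarith [mul_le_mul_of_nonneg_left hL hn0]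
  have hLx2 : 1000 * (x * L) ≤ x ^ 2 := by linarith [mul_le_mul_of_nonneg_left hLn' hn0]
  have hx2 : 500000 * x ≤ x ^ 2 := by linarith [mul_le_mul_of_nonneg_right hxn hn0]
  set M : ℕ := n * (n - 1) / 2 with hMdef
  have hM1 : (M : ℝ) ≤ x ^ 2 / 2 := by linarith
  have hM2 : 0.49 * x ^ 2 ≤ (M : ℝ) - x := by linarith
  have hMpos : (0 : ℝ) < M := by linarith
  obtain ⟨m₁, hm₁⟩ : ∃ m, m = ⌊0.45 * (x * L)⌋₊ := ⟨_, rfl⟩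
  obtain ⟨m₂, hm₂⟩ : ∃ m, m = ⌊2 * (x * L)⌋₊ := ⟨_, rfl⟩
  have u1 : (m₁ : ℝ) ≤ 0.45 * (x * L) := by rw [hm₁]; exact Nat.floor_le (by linarith)
  have u2 : (m₂ : ℝ) ≤ 2 * (x * L) := by rw [hm₂]; exact Nat.floor_le (by linarith)
  have l1 : 0.45 * (x * L) < m₁ + 1 := by rw [hm₁]; exact Nat.lt_floor_add_one _
  have l2 : 2 * (x * L) < m₂ + 1 := by rw [hm₂]; exact Nat.lt_floor_add_one _
  have l1' : 0.44 * (x * L) + x ≤ m₁ := by linarith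
  have l2' : 1.9 * (x * L) ≤ m₂ := by linarith
  have b2 : m₂ ≤ M := by exact_mod_cast (by linarith : (m₂ : ℝ) ≤ M)
  have b12 : m₁ ≤ m₂ := by exact_mod_cast (by linarith : (m₁ : ℝ) ≤ m₂)
  have b1 : m₁ ≤ M := b12.trans b2
  have hM0 : 0 < M := by exact_mod_cast hMpos
  have bn1 : n ≤ m₁ := by rw [← Nat.cast_le (α := ℝ), ← hx]; linarith
  have bnM : n < M := by rw [← Nat.cast_lt (α := ℝ), ← hx]; linarith
  have bm : m₁ + 2 * n < M := by
    rw [← Nat.cast_lt (α := ℝ)]; push_cast; rw [← hx]; linarith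
  have bn : 12 ≤ n := by rw [← Nat.cast_le (α := ℝ), ← hx]; push_cast; linarith
  refine ⟨bn, m₁, m₂, b12, ?_⟩
  have P1 : unifProb (HasLowDegree n m₂) ≤ ε := by
    refine (unifProb_hasLowDegree_le b2 hM0).trans (le_trans ?_ he1)
    rw [← hx]
    have h : 3 * L ≤ m₂ * (x - 2) / M := by
      rw [le_div_iff₀ hMpos]
      linarith [mul_le_mul_of_nonneg_left hM1 (by linarith : 0 ≤ L),
        mul_le_mul_of_nonneg_right l2' (by linarith : 0 ≤ x - 2),
        mul_le_mul_of_nonneg_right hxn (by linarith : 0 ≤ x * L)]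
    calc x ^ 2 * Real.exp (-(m₂ * (x - 2) / M)) ≤ Real.exp L ^ 2 * Real.exp (-(3 * L)) := by
          rw [hexpL]; gcongr
      _ = Real.exp (-L) := by
          rw [← Real.exp_nat_mul, ← Real.exp_add]; congr 1; push_cast; ring
  have P2 : unifProb (fun σ => ¬ HasIsolated n m₁ σ) ≤ 3 * ε := by
    rw [unifProb_not]
    set θ : ℝ := 0.92 * L / x with hθ
    have hx0 : 0 < x := by linarith
    have hθx : θ * x = 0.92 * L := by rw [hθ]; field_simp
    have hθ0 : 0 ≤ θ := by positivity
    have hθε : θ ≤ 0.92 * ε := by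
      rw [hθ, div_le_iff₀ hx0]; linarith
    have hθ1 : θ ≤ 1 / 1000 := by linarith
    have h := unifProb_hasIsolated_ge (by omega) bm θ (by
      rw [← hx, ← hMdef, div_le_iff₀ (by linarith)]
      have : θ * (0.49 * x ^ 2) = 0.92 * 0.49 * (x * L) := by
        rw [show θ * (0.49 * x ^ 2) = (θ * x) * (0.49 * x) by ring, hθx]; ring
      have := mul_le_mul_of_nonneg_left hM2 hθ0
      linarith) (by linarith)
    rw [← hx] at h
    have hpow := exp_neg_le_one_sub_pow hθ0 hθ1 n
    rw [← hx, mul_assoc, hθx] at hpow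
    have hinv1 : 1 / (x * (1 - θ) ^ n) ≤ ε := by
      refine le_trans ?_ he2
      rw [Real.exp_neg, ← one_div]
      refine one_div_le_one_div_of_le (Real.exp_pos _) ?_
      calc Real.exp (0.05 * L) ≤ Real.exp L * Real.exp (-(1.01 * (0.92 * L))) := by
            rw [← Real.exp_add, Real.exp_le_exp]; linarith
        _ ≤ x * (1 - θ) ^ n := by rw [hexpL]; gcongr
    have hinv2 : 1 / (1 - θ) ≤ 1 + 2 * ε := by
      rw [div_le_iff₀ (by linarith)]
      linarith [mul_le_mul_of_nonneg_right hθ1 hε0.le]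
    set u := 1 / (x * (1 - θ) ^ n) + 1 / (1 - θ) with hu
    have hu0 : 0 < u := by
      have h1 : 0 < 1 - θ := by linarith
      positivity
    have h2 : 2 - u ≤ u⁻¹ := by
      rw [← one_div, le_div_iff₀ hu0]
      nlinarith [sq_nonneg (u - 1)]
    linarith
  have P3 : unifProb (HasLargeHole n m₁) ≤ ε := by
    refine (unifProb_hasLargeHole_le b1 hM0).trans (le_trans ?_ he1)
    rw [← hx]
    have h4 : (4 : ℝ) ≤ Real.exp 2 := by
      have h1 := Real.add_one_le_exp (1 : ℝ)
      have h2 : Real.exp 2 = Real.exp 1 * Real.exp 1 := by rw [← Real.exp_add]; norm_num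
      nlinarith
    have h : 3 * x ≤ m₁ * (x ^ 2 / 144) / M := by
      rw [le_div_iff₀ hMpos]
      linarith [mul_le_mul_of_nonneg_left hM1 hn0,
        mul_le_mul_of_nonneg_right l1' (sq_nonneg x),
        mul_le_mul_of_nonneg_right hxL (sq_nonneg x), mul_nonneg hn0 (sq_nonneg x)]
    calc (4 : ℝ) ^ n * Real.exp (-(m₁ * (x ^ 2 / 144) / M))
        ≤ Real.exp 2 ^ n * Real.exp (-(3 * x)) := by gcongr
      _ = Real.exp (-x) := by
          rw [← Real.exp_nat_mul, ← Real.exp_add, ← hx]; congr 1; ring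
      _ ≤ Real.exp (-L) := by
          rw [Real.exp_le_exp]; linarith
  have P4 : unifProb (HasTightSet n m₁ m₂) ≤ 2 * ε := by
    have hden : (0 : ℝ) < M - x := by linarith
    have h := unifProb_hasTightSet_le b1 b2 bn1 bnM (5 * L) (Real.exp (-(0.7 * L)))
      (by linarith) (Real.exp_pos _).le (by
        rw [← hx, ← hMdef, div_le_div_iff₀ hden (by linarith)]
        nlinarith) (by
        intro s hs
        rw [← hx, ← hMdef]
        have hs' : 6 * (s : ℝ) < x := by rw [hx]; exact_mod_cast hs
        have hcast : ((n - s - 1 : ℕ) : ℝ) = x - s - 1 := by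
          rw [Nat.cast_sub (by omega), Nat.cast_sub (by omega), hx, Nat.cast_one]
        have hbase : ((M : ℝ) - m₁) / (M - x) ≤ Real.exp (-((m₁ - x) / M)) := by
          refine le_trans ?_ (Real.add_one_le_exp _)
          rw [div_le_iff₀ hden]
          have hMm : (m₁ : ℝ) ≤ M := by exact_mod_cast b1
          have e : (-((m₁ - x) / M) + 1) * (M - x) = M - m₁ + (m₁ - x) * x / M := by
            field_simp; ring
          rw [e]
          have : 0 ≤ (m₁ - x) * x / M := div_nonneg (mul_nonneg (by linarith) (by linarith)) hMpos.le
          linarith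
        calc (((M : ℝ) - m₁) / (M - x)) ^ (n - s - 1)
            ≤ Real.exp (-((m₁ - x) / M)) ^ (n - s - 1) := by
              refine pow_le_pow_left₀ (div_nonneg ?_ hden.le) hbase _
              rw [sub_nonneg]; exact_mod_cast b1
          _ = Real.exp (-((m₁ - x) * (x - s - 1) / M)) := by
              rw [← Real.exp_nat_mul, hcast]; congr 1; ring
          _ ≤ Real.exp (-(0.7 * L)) := by
              rw [Real.exp_le_exp, neg_le_neg_iff, le_div_iff₀ hMpos]
              have h1 : 0.83 * x ≤ x - s - 1 := by linarith
              have h2 : 0.44 * (x * L) ≤ m₁ - x := by linarith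
              have h3 := mul_le_mul h2 h1 (by linarith) (by linarith)
              have h4 := mul_le_mul_of_nonneg_left hM1 (by linarith : 0 ≤ 0.7 * L)
              linarith [mul_nonneg (sq_nonneg x) (by linarith : 0 ≤ L)]) (by
        rw [← hx]; linarith)
    rw [← hx] at h
    linarith
  have h1 := unifProb_or_le (HasLowDegree n m₂)
    (fun σ => ¬ HasIsolated n m₁ σ ∨ HasLargeHole n m₁ σ ∨ HasTightSet n m₁ m₂ σ)
  have h2 := unifProb_or_le (fun σ => ¬ HasIsolated n m₁ σ)
    (fun σ => HasLargeHole n m₁ σ ∨ HasTightSet n m₁ m₂ σ)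
  have h3 := unifProb_or_le (HasLargeHole n m₁) (HasTightSet n m₁ m₂)
  linarith

end Main

theorem stmt2 : ∀ δ : ℝ, 0 < δ → ∃ N : ℕ, ∀ n : ℕ, N ≤ n →
    (1 - δ) * (Nat.factorial (n * (n - 1) / 2) : ℝ) ≤
      (Nat.card {σ : Fin (n * (n - 1) / 2) ≃ (⊤ : SimpleGraph (Fin n)).edgeSet //
        GloballyRigid (processGraph n (hittingTimeMinDeg2 n σ) σ)} : ℝ) := by
  classical
  intro δ hδ
  have hε : 0 < min (δ / 7) (1 / 1000) := lt_min (by positivity) (by norm_num)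
  obtain ⟨N, hN⟩ := Filter.eventually_atTop.1 (eventually_exp_bounds hε)
  refine ⟨N, fun n hn => ?_⟩
  obtain ⟨h1, h2, h3, h4, h5⟩ := hN n hn
  have hn0 : (0 : ℝ) < n := by
    rcases n.eq_zero_or_pos with rfl | h
    · norm_num at h1
    · exact_mod_cast h
  obtain ⟨hn12, m₁, m₂, hm, hfail⟩ := unifProb_failure_le (x := n) (L := Real.log n) rfl
    (Real.exp_log hn0) (min_le_right _ _) h1 h2 h3 h4 h5
  have := nonempty_ordering n
  have hprob := one_sub_le_unifProb (fun σ => HasLowDegree n m₂ σ ∨ ¬ HasIsolated n m₁ σ ∨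
      HasLargeHole n m₁ σ ∨ HasTightSet n m₁ m₂ σ)
    (fun σ => GloballyRigid (processGraph n (hittingTimeMinDeg2 n σ) σ)) fun σ hσ => by
      simp only [not_or, not_not] at hσ
      exact globallyRigid_hittingTime hn12 hm hσ.1 hσ.2.1 hσ.2.2.1 hσ.2.2.2
  have hδ' : 1 - δ ≤ unifProb
      (fun σ => GloballyRigid (processGraph n (hittingTimeMinDeg2 n σ) σ)) := by
    linarith [min_le_left (δ / 7) (1 / 1000 : ℝ)]
  rw [unifProb_eq, Fintype.card_equiv (Classical.arbitrary _), Fintype.card_fin,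
    le_div_iff₀ (by positivity)] at hδ'
  rwa [Nat.card_eq_fintype_card, Fintype.card_subtype]
end

section
/- For every ε > 0 there exists C > 0 such that for every δ > 0 there exists N such that for all n ≥ N the following holds with p = min(C/n, 1): the G(n,p)-probability of the set of simple graphs G on Fin n for which there exists a subset V' ⊆ Fin n with |V'| ≥ (1 − ε)·n such that the induced subgraph G[V'] is globally rigid in ℝ is at least 1 − δ. -/
open Classical in
/-- The probability, under the Erdős–Rényi measure `G(n,p)`, of the set of simple
graphs on `Fin n` satisfying the predicate `P`. -/
noncomputable def erProb (n : ℕ) (p : ℝ) (P : SimpleGraph (Fin n) → Prop) : ℝ :=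
  ∑ G : SimpleGraph (Fin n),
    if P G then p ^ G.edgeSet.ncard * (1 - p) ^ (n * (n - 1) / 2 - G.edgeSet.ncard) else 0

open Finset in
/-- Any two disjoint vertex sets of size `k` are joined by an edge. -/
def SimpleGraph.HasCrossEdges {V : Type*} (G : SimpleGraph V) (k : ℕ) : Prop :=
  ∀ X Y : Finset V, #X = k → #Y = k → Disjoint X Y → ∃ x ∈ X, ∃ y ∈ Y, G.Adj x y

section Deterministic

open Finset

variable {V : Type*}

lemma SimpleGraph.HasCrossEdges.exists_adj {G : SimpleGraph V} {k : ℕ} (hG : G.HasCrossEdges k)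
    {X Y : Finset V} (hX : k ≤ #X) (hY : k ≤ #Y) (hXY : Disjoint X Y) :
    ∃ x ∈ X, ∃ y ∈ Y, G.Adj x y := by
  obtain ⟨X', hX', hX'k⟩ := exists_subset_card_eq hX
  obtain ⟨Y', hY', hY'k⟩ := exists_subset_card_eq hY
  obtain ⟨x, hx, y, hy, h⟩ := hG X' Y' hX'k hY'k (disjoint_of_subset_left hX'
    (disjoint_of_subset_right hY' hXY))
  exact ⟨x, hX' hx, y, hY' hy, h⟩

lemma SimpleGraph.HasCrossEdges.induce {G : SimpleGraph V} {k : ℕ} (hG : G.HasCrossEdges k)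
    (s : Set V) : (G.induce s).HasCrossEdges k := by
  intro X Y hX hY hXY
  obtain ⟨x, hx, y, hy, h⟩ := hG (X.map (Function.Embedding.subtype _))
    (Y.map (Function.Embedding.subtype _)) (by simpa using hX) (by simpa using hY)
    ((disjoint_map _).2 hXY)
  simp only [mem_map, Function.Embedding.subtype_apply] at hx hy
  obtain ⟨x, hx, rfl⟩ := hx
  obtain ⟨y, hy, rfl⟩ := hy
  exact ⟨x, hx, y, hy, h⟩

/-- Removing few vertices from a graph with cross edges, every small set of remaining vertices
contains a vertex with two remaining neighbours outside the set. -/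
lemma SimpleGraph.HasCrossEdges.exists_small_removal [Fintype V] [DecidableEq V]
    {G : SimpleGraph V} {k : ℕ} (hG : G.HasCrossEdges k) (hk : 11 * k ≤ Fintype.card V) :
    ∃ T : Finset V, #T ≤ k ∧ ∀ S : Finset V, Disjoint S T → S.Nonempty → #S ≤ 4 * k →
      ∃ v ∈ S, ∃ u w, u ≠ w ∧ u ∉ T ∪ S ∧ w ∉ T ∪ S ∧ G.Adj v u ∧ G.Adj v w := by
  classical
  let F : Finset (Finset V) := univ.filter fun T => #T ≤ 5 * k ∧
    ∀ v ∈ T, ∀ u w, u ∉ T → w ∉ T → G.Adj v u → G.Adj v w → u = w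
  obtain ⟨T, hTF, hmax⟩ := exists_max_image F card ⟨∅, by simp [F]⟩
  obtain ⟨hT5, hT⟩ : #T ≤ 5 * k ∧
    ∀ v ∈ T, ∀ u w, u ∉ T → w ∉ T → G.Adj v u → G.Adj v w → u = w := by simpa [F] using hTF
  have hTk : #T ≤ k := by
    by_contra! hlt
    let N : Finset V := univ.filter fun u => u ∉ T ∧ ∃ v ∈ T, G.Adj v u
    have hN : ∀ u ∈ N, ∃ v ∈ T, G.Adj v u := fun u hu => (mem_filter.1 hu).2.2
    have hN' : ∀ u ∈ N, u ∉ T := fun u hu => (mem_filter.1 hu).2.1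
    choose! h hhT hadj using hN
    have hNT : #N ≤ #T := by
      refine card_le_card_of_injOn h hhT fun u hu w hw huw => ?_
      exact hT (h u) (hhT u hu) u w (hN' u hu) (hN' w hw) (hadj u hu) (huw ▸ hadj w hw)
    have hcard : k ≤ #((T ∪ N)ᶜ) := by
      have := card_union_le T N
      rw [card_compl]
      omega
    obtain ⟨x, hx, y, hy, hxy⟩ := hG.exists_adj hlt.le hcard
      (disjoint_of_subset_left subset_union_left disjoint_compl_right)
    simp only [mem_compl, mem_union, not_or] at hy
    exact hy.2 (mem_filter.2 ⟨mem_univ _, hy.1, x, hx, hxy⟩)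
  refine ⟨T, hTk, fun S hST hS hS4 => ?_⟩
  by_contra! hcon
  have hcard : #(T ∪ S) = #T + #S := card_union_of_disjoint hST.symm
  have hmem : T ∪ S ∈ F := by
    refine mem_filter.2 ⟨mem_univ _, by omega, fun v hv u w hu hw hvu hvw => ?_⟩
    rcases mem_union.1 hv with hv | hv
    · exact hT v hv u w (fun h => hu (mem_union_left _ h)) (fun h => hw (mem_union_left _ h))
        hvu hvw
    · by_contra huw
      exact hcon v hv u w huw hu hw hvu hvw
  have := hmax _ hmem
  have := hS.card_pos
  omega

/-- A real function on a finite set which cannot be cut into two parts of size `l` by a threshold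
is constant outside a set of size less than `2 * l`. -/
lemma exists_large_fiber_of_forall_threshold [Fintype V] (a : V → ℝ) {l : ℕ} (hl : 0 < l)
    (hV : l ≤ Fintype.card V)
    (ha : ∀ t, l ≤ #{x | a x ≤ t} → #{x | t < a x} < l) :
    ∃ t, #{x | a x ≠ t} < 2 * l := by
  classical
  have hne : Nonempty V := Fintype.card_pos_iff.1 (by omega)
  let I : Finset V := univ.filter fun x => l ≤ #{y | a y ≤ a x}
  have hI : I.Nonempty := by
    obtain ⟨x, -, hx⟩ := exists_max_image univ a univ_nonempty
    refine ⟨x, mem_filter.2 ⟨mem_univ _, ?_⟩⟩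
    rwa [filter_true_of_mem fun y _ => hx y (mem_univ _), card_univ]
  obtain ⟨x, hxI, hx⟩ := exists_min_image I a hI
  have hlt : #{y | a y < a x} < l := by
    by_contra! hge
    obtain ⟨z, hz, hzmax⟩ := exists_max_image (univ.filter fun y => a y < a x) a
      (card_pos.1 (by omega))
    have hz' := (mem_filter.1 hz).2
    refine absurd (hx z (mem_filter.2 ⟨mem_univ _, hge.trans (card_le_card fun y hy => ?_)⟩))
      (not_le.2 hz')
    exact mem_filter.2 ⟨mem_univ _, hzmax y hy⟩
  have hgt := ha (a x) (mem_filter.1 hxI).2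
  refine ⟨a x, ?_⟩
  have hsub : (univ.filter fun y => a y ≠ a x) ⊆
      (univ.filter fun y => a y < a x) ∪ (univ.filter fun y => a x < a y) := by
    intro y hy
    simpa using (mem_filter.1 hy).2
  have := (card_le_card hsub).trans (card_union_le _ _)
  omega

/-- If the edges of a graph with cross edges are axis-parallel in the plane, then two pairs of
complementary half-planes, bounded by parallels to the two axes, cannot all be heavy. -/
lemma SimpleGraph.HasCrossEdges.halfplane_card_lt [Fintype V] {G : SimpleGraph V} {k : ℕ}
    (hG : G.HasCrossEdges k) {a b : V → ℝ} (hab : ∀ x y, G.Adj x y → a x = a y ∨ b x = b y)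
    {s t : ℝ} (h₁ : 2 * k ≤ #{x | a x ≤ s}) (h₂ : 2 * k ≤ #{x | s < a x})
    (h₃ : 2 * k ≤ #{x | b x ≤ t}) : #{x | t < b x} < 2 * k := by
  classical
  by_contra! h₄
  have key₁ : #{x | a x ≤ s ∧ b x ≤ t} < k ∨ #{x | s < a x ∧ t < b x} < k := by
    by_contra! h
    obtain ⟨x, hx, y, hy, hxy⟩ := hG.exists_adj h.1 h.2 (by
      rw [disjoint_filter]; intro x _ h h'; linarith [h.1, h'.1])
    simp only [mem_filter, mem_univ, true_and] at hx hy
    rcases hab x y hxy with h | h <;> linarith [hx.1, hx.2, hy.1, hy.2]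
  have key₂ : #{x | a x ≤ s ∧ t < b x} < k ∨ #{x | s < a x ∧ b x ≤ t} < k := by
    by_contra! h
    obtain ⟨x, hx, y, hy, hxy⟩ := hG.exists_adj h.1 h.2 (by
      rw [disjoint_filter]; intro x _ h h'; linarith [h.1, h'.1])
    simp only [mem_filter, mem_univ, true_and] at hx hy
    rcases hab x y hxy with h | h <;> linarith [hx.1, hx.2, hy.1, hy.2]
  have split : ∀ p q : V → Prop, #{x | p x} = #{x | p x ∧ q x} + #{x | p x ∧ ¬ q x} := by
    intro p q
    rw [← filter_filter, ← filter_filter, card_filter_add_card_filter_not]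
  have e₁ := split (fun x => a x ≤ s) fun x => b x ≤ t
  have e₂ := split (fun x => s < a x) fun x => b x ≤ t
  have e₃ := split (fun x => b x ≤ t) fun x => a x ≤ s
  have e₄ := split (fun x => t < b x) fun x => a x ≤ s
  simp only [not_le, and_comm (a := b _ ≤ t), and_comm (a := t < b _)] at e₁ e₂ e₃ e₄
  omega

/-- Axis-parallel drawings with one heavy line lie entirely on that line. -/
lemma eq_of_card_ne_lt [Fintype V] {G : SimpleGraph V} {l : ℕ}
    (hS : ∀ S : Finset V, S.Nonempty → #S ≤ l →
      ∃ v ∈ S, ∃ u w, u ≠ w ∧ u ∉ S ∧ w ∉ S ∧ G.Adj v u ∧ G.Adj v w)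
    {a b : V → ℝ} (hinj : ∀ x y, a x = a y → b x = b y → x = y)
    (hab : ∀ x y, G.Adj x y → a x = a y ∨ b x = b y) {t : ℝ} (ht : #{x | a x ≠ t} < l) (x : V) :
    a x = t := by
  by_contra hx
  obtain ⟨v, hv, u, w, huw, hu, hw, hvu, hvw⟩ := hS _ ⟨x, by simpa using hx⟩ ht.le
  simp only [mem_filter, mem_univ, true_and, not_not] at hv hu hw
  have hbu := (hab v u hvu).resolve_left (by rwa [hu])
  have hbw := (hab v w hvw).resolve_left (by rwa [hw])
  exact huw (hinj u w (hu.trans hw.symm) (hbu.symm.trans hbw))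

lemma SimpleGraph.HasCrossEdges.globallyRigid [Fintype V] {G : SimpleGraph V} {k : ℕ}
    (hG : G.HasCrossEdges k) (hk : 0 < k) (hV : 2 * k ≤ Fintype.card V)
    (hS : ∀ S : Finset V, S.Nonempty → #S ≤ 4 * k →
      ∃ v ∈ S, ∃ u w, u ≠ w ∧ u ∉ S ∧ w ∉ S ∧ G.Adj v u ∧ G.Adj v w) :
    GloballyRigid G := by
  intro f g hf _ hfg
  have hab : ∀ x y, G.Adj x y → f x - g x = f y - g y ∨ f x + g x = f y + g y := by
    intro x y hxy
    rcases abs_eq_abs.1 (hfg x y hxy) with h | h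
    · left; linarith
    · right; linarith
  have hinj : ∀ x y, f x - g x = f y - g y → f x + g x = f y + g y → x = y :=
    fun x y h h' => hf (by linarith)
  by_cases ha : ∀ t, 2 * k ≤ #{x | f x - g x ≤ t} → #{x | t < f x - g x} < 2 * k
  · obtain ⟨t, ht⟩ := exists_large_fiber_of_forall_threshold _ (by omega) hV ha
    have hconst := eq_of_card_ne_lt hS hinj hab (t := t) (by omega)
    intro x y
    congr 1
    linarith [hconst x, hconst y]
  · push Not at ha
    obtain ⟨s, h₁, h₂⟩ := ha
    obtain ⟨t, ht⟩ := exists_large_fiber_of_forall_threshold (fun x => f x + g x) (by omega) hV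
      fun t h₃ => hG.halfplane_card_lt hab h₁ h₂ h₃
    have hconst := eq_of_card_ne_lt hS (fun x y h h' => hinj x y h' h)
      (fun x y h => (hab x y h).symm) (t := t) (by omega)
    intro x y
    rw [← abs_neg (g x - g y)]
    congr 1
    linarith [hconst x, hconst y]

/-- A graph with cross edges is globally rigid after removing few vertices. -/
lemma SimpleGraph.HasCrossEdges.exists_globallyRigid_induce [Fintype V] {G : SimpleGraph V}
    {k : ℕ} (hG : G.HasCrossEdges k) (hk : 0 < k) (hV : 11 * k ≤ Fintype.card V) :
    ∃ V' : Finset V, Fintype.card V ≤ #V' + k ∧ GloballyRigid (G.induce (V' : Set V)) := by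
  classical
  obtain ⟨T, hT, h⟩ := hG.exists_small_removal hV
  have hcard : #Tᶜ + #T = Fintype.card V := card_compl_add_card T
  refine ⟨Tᶜ, by omega, (hG.induce _).globallyRigid hk ?_ fun S hS hS4 => ?_⟩
  · simp only [coe_sort_coe, Fintype.card_coe]
    omega
  obtain ⟨v, hv, u, w, huw, hu, hw, hvu, hvw⟩ := h (S.map (Function.Embedding.subtype _))
    (by
      rw [Finset.disjoint_left]
      intro x hx
      obtain ⟨y, -, rfl⟩ := mem_map.1 hx
      simpa using y.2) (by simpa using hS) (by simpa using hS4)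
  obtain ⟨v, hvS, rfl⟩ := mem_map.1 hv
  simp only [mem_union, not_or] at hu hw
  have hu' : u ∈ ((Tᶜ : Finset V) : Set V) := by simpa using hu.1
  have hw' : w ∈ ((Tᶜ : Finset V) : Set V) := by simpa using hw.1
  exact ⟨v, hvS, ⟨u, hu'⟩, ⟨w, hw'⟩, by simpa using huw,
    fun h => hu.2 (mem_map.2 ⟨_, h, rfl⟩), fun h => hw.2 (mem_map.2 ⟨_, h, rfl⟩), hvu, hvw⟩

end Deterministic

section Probability

open Finset

variable {n : ℕ} {p : ℝ}

lemma erProb_mono (hp₀ : 0 ≤ p) (hp₁ : p ≤ 1) {P Q : SimpleGraph (Fin n) → Prop}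
    (h : ∀ G, P G → Q G) : erProb n p P ≤ erProb n p Q := by
  have : 0 ≤ 1 - p := by linarith
  refine sum_le_sum fun G _ => ?_
  by_cases hP : P G
  · rw [if_pos hP, if_pos (h G hP)]
  · rw [if_neg hP]
    split_ifs <;> positivity

lemma erProb_add_erProb_not (P : SimpleGraph (Fin n) → Prop) :
    erProb n p P + erProb n p (fun G => ¬ P G) = erProb n p fun _ => True := by
  simp only [erProb, ← sum_add_distrib]
  refine sum_congr rfl fun G _ => ?_
  by_cases hP : P G <;> simp [hP]

lemma erProb_exists_le {ι : Type*} (hp₀ : 0 ≤ p) (hp₁ : p ≤ 1) (s : Finset ι)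
    (P : ι → SimpleGraph (Fin n) → Prop) :
    erProb n p (fun G => ∃ i ∈ s, P i G) ≤ ∑ i ∈ s, erProb n p (P i) := by
  have : 0 ≤ 1 - p := by linarith
  simp only [erProb]
  rw [sum_comm]
  refine sum_le_sum fun G _ => ?_
  split_ifs with h
  · obtain ⟨i, hi, hP⟩ := h
    refine le_trans (le_of_eq ?_) (single_le_sum (fun j _ => ?_) hi)
    · rw [if_pos hP]
    · split_ifs <;> positivity
  · refine sum_nonneg fun j _ => ?_
    split_ifs <;> positivity

/-- The probability that a random graph avoids a set `F` of pairs is `(1 - p) ^ #F`. -/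
lemma erProb_disjoint_edgeSet {F : Finset (Sym2 (Fin n))} (hF : ∀ e ∈ F, ¬ e.IsDiag) :
    erProb n p (fun G => Disjoint G.edgeSet (F : Set (Sym2 (Fin n)))) = (1 - p) ^ #F := by
  classical
  let E : Finset (Sym2 (Fin n)) := (⊤ : SimpleGraph (Fin n)).edgeFinset
  have hE : ∀ e, e ∈ E ↔ ¬ e.IsDiag := by intro e; simp [E]
  have hFE : F ⊆ E := fun e he => (hE e).2 (hF e he)
  have hcardE : #E = n * (n - 1) / 2 := by
    rw [SimpleGraph.card_edgeFinset_top_eq_card_choose_two, Fintype.card_fin, Nat.choose_two_right]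
  have hcard : #(E \ F) + #F = n * (n - 1) / 2 := by
    rw [← hcardE, card_sdiff_add_card_eq_card hFE]
  have hsum : ∑ s ∈ (E \ F).powerset, p ^ #s * (1 - p) ^ (n * (n - 1) / 2 - #s) =
      (1 - p) ^ #F := by
    calc _ = ∑ s ∈ (E \ F).powerset, (1 - p) ^ #F * (p ^ #s * (1 - p) ^ (#(E \ F) - #s)) := by
          refine sum_congr rfl fun s hs => ?_
          have := card_le_card (mem_powerset.1 hs)
          rw [show n * (n - 1) / 2 - #s = #F + (#(E \ F) - #s) by omega, pow_add]
          ring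
      _ = _ := by rw [← mul_sum, sum_pow_mul_eq_add_pow]; simp
  rw [← hsum, erProb, ← sum_filter]
  refine sum_bij' (fun G _ => G.edgeFinset) (fun s _ => SimpleGraph.fromEdgeSet s) ?_ ?_ ?_ ?_ ?_
  · intro G hG
    have hG := (mem_filter.1 hG).2
    refine mem_powerset.2 fun e he => mem_sdiff.2 ⟨(hE e).2 ?_, fun heF => ?_⟩
    · exact G.not_isDiag_of_mem_edgeFinset he
    · exact Set.disjoint_left.1 hG (SimpleGraph.mem_edgeFinset.1 he) heF
  · intro s hs
    refine mem_filter.2 ⟨mem_univ _, Set.disjoint_left.2 fun e he heF => ?_⟩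
    rw [SimpleGraph.edgeSet_fromEdgeSet] at he
    exact (mem_sdiff.1 (mem_powerset.1 hs he.1)).2 heF
  · intro G _
    simp
  · intro s hs
    ext e
    simp only [SimpleGraph.mem_edgeFinset, SimpleGraph.edgeSet_fromEdgeSet, Set.mem_sdiff, mem_coe]
    exact ⟨fun h => h.1, fun h => ⟨h, (hE e).1 (mem_sdiff.1 (mem_powerset.1 hs h)).1⟩⟩
  · intro G _
    rw [← SimpleGraph.coe_edgeFinset, Set.ncard_coe_finset]

lemma erProb_true : erProb n p (fun _ => True) = 1 := by
  simpa using erProb_disjoint_edgeSet (n := n) (p := p) (F := ∅) (by simp)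

lemma erProb_forall_not_adj_le (hp₀ : 0 ≤ p) (hp₁ : p ≤ 1) {X Y : Finset (Fin n)}
    (hXY : Disjoint X Y) :
    erProb n p (fun G => ∀ x ∈ X, ∀ y ∈ Y, ¬ G.Adj x y) ≤ (1 - p) ^ (#X * #Y) := by
  classical
  have hne : ∀ x ∈ X, ∀ y ∈ Y, x ≠ y := fun x hx y hy h => disjoint_left.1 hXY hx (h ▸ hy)
  let F : Finset (Sym2 (Fin n)) := (X ×ˢ Y).image fun q => s(q.1, q.2)
  have hF : #F = #X * #Y := by
    rw [← card_product]
    refine card_image_of_injOn ?_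
    rintro ⟨x, y⟩ h ⟨x', y'⟩ h' heq
    simp only [coe_product, Set.mem_prod, mem_coe] at h h'
    rcases Sym2.eq_iff.1 heq with ⟨h₁, h₂⟩ | ⟨h₁, h₂⟩
    · exact Prod.ext h₁ h₂
    · exact absurd h₁ (hne _ h.1 _ h'.2)
  rw [← hF, ← erProb_disjoint_edgeSet]
  · refine erProb_mono hp₀ hp₁ fun G hG => Set.disjoint_left.2 fun e he heF => ?_
    obtain ⟨⟨x, y⟩, hxy, rfl⟩ := mem_image.1 (mem_coe.1 heF)
    have hxy := mem_product.1 hxy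
    exact hG x hxy.1 y hxy.2 he
  · intro e he
    obtain ⟨⟨x, y⟩, hxy, rfl⟩ := mem_image.1 he
    have hxy := mem_product.1 hxy
    simpa using hne x hxy.1 y hxy.2

/-- A union bound for the event that some two disjoint `k`-sets are not joined by an edge. -/
lemma le_erProb_hasCrossEdges (hp₀ : 0 ≤ p) (hp₁ : p ≤ 1) (k : ℕ) :
    1 - 4 ^ n * (1 - p) ^ (k * k) ≤ erProb n p fun G => G.HasCrossEdges k := by
  classical
  have hq : 0 ≤ 1 - p := by linarith
  let I : Finset (Finset (Fin n) × Finset (Fin n)) :=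
    univ.filter fun q => #q.1 = k ∧ #q.2 = k ∧ Disjoint q.1 q.2
  have hI : (#I : ℝ) ≤ 4 ^ n := by
    have h : #I ≤ 4 ^ n := by
      refine (card_le_univ I).trans (le_of_eq ?_)
      rw [Fintype.card_prod, Fintype.card_finset, Fintype.card_fin, ← mul_pow]
      norm_num
    exact_mod_cast h
  have hnot : erProb n p (fun G => ¬ G.HasCrossEdges k) ≤ 4 ^ n * (1 - p) ^ (k * k) :=
    calc _ ≤ erProb n p (fun G => ∃ q ∈ I, ∀ x ∈ q.1, ∀ y ∈ q.2, ¬ G.Adj x y) := by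
          refine erProb_mono hp₀ hp₁ fun G hG => ?_
          simp only [SimpleGraph.HasCrossEdges] at hG
          push Not at hG
          obtain ⟨X, Y, hX, hY, hXY, h⟩ := hG
          exact ⟨(X, Y), mem_filter.2 ⟨mem_univ _, hX, hY, hXY⟩, h⟩
      _ ≤ ∑ q ∈ I, erProb n p (fun G => ∀ x ∈ q.1, ∀ y ∈ q.2, ¬ G.Adj x y) :=
          erProb_exists_le hp₀ hp₁ I fun q G => ∀ x ∈ q.1, ∀ y ∈ q.2, ¬ G.Adj x y
      _ ≤ ∑ q ∈ I, (1 - p) ^ (k * k) := by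
          refine sum_le_sum fun q hq => ?_
          obtain ⟨hX, hY, hXY⟩ := (mem_filter.1 hq).2
          have := erProb_forall_not_adj_le hp₀ hp₁ hXY
          rwa [hX, hY] at this
      _ ≤ _ := by
          rw [sum_const, nsmul_eq_mul]
          gcongr
  have := erProb_add_erProb_not (p := p) fun G : SimpleGraph (Fin n) => G.HasCrossEdges k
  rw [erProb_true] at this
  linarith

end Probability

/-- With `C = 16 / γ ^ 2` and `k ≥ γ n / 2`, the union bound decays like `1 / n`. -/
lemma four_pow_mul_one_sub_pow_le {γ : ℝ} (hγ : 0 < γ) {n k : ℕ} (hn : 0 < n)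
    (hk : γ * n / 2 ≤ k) (hC : 16 / γ ^ 2 ≤ n) :
    4 ^ n * (1 - 16 / γ ^ 2 / n) ^ (k * k) ≤ 1 / (n : ℝ) := by
  have hn' : (0 : ℝ) < n := by exact_mod_cast hn
  have hp : 16 / γ ^ 2 / n ≤ 1 := (div_le_one hn').2 hC
  have hsq : 4 * (n : ℝ) ≤ 16 / γ ^ 2 / n * (k * k) :=
    calc 4 * (n : ℝ) = 16 / γ ^ 2 / n * (γ * n / 2 * (γ * n / 2)) := by field_simp; norm_num
      _ ≤ _ := by gcongr
  have h₁ : (1 - 16 / γ ^ 2 / n) ^ (k * k) ≤ Real.exp (-(4 * n)) :=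
    calc _ ≤ Real.exp (-(16 / γ ^ 2 / n)) ^ (k * k) := by
          exact pow_le_pow_left₀ (by linarith) (Real.one_sub_le_exp_neg _) _
      _ = Real.exp (-(16 / γ ^ 2 / n * (k * k))) := by
          rw [← Real.exp_nat_mul]
          push_cast
          ring_nf
      _ ≤ _ := by gcongr
  have h₂ : (4 : ℝ) ^ n ≤ Real.exp (3 * n) := by
    rw [mul_comm, Real.exp_nat_mul]
    gcongr
    linarith [Real.add_one_le_exp (3 : ℝ)]
  calc _ ≤ Real.exp (3 * n) * Real.exp (-(4 * n)) := by gcongr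
    _ = 1 / Real.exp n := by rw [← Real.exp_add, one_div, ← Real.exp_neg]; ring_nf
    _ ≤ _ := by
        gcongr
        linarith [Real.add_one_le_exp (n : ℝ)]

theorem stmt3 : ∀ ε : ℝ, 0 < ε → ∃ C : ℝ, 0 < C ∧ ∀ δ : ℝ, 0 < δ → ∃ N : ℕ,
    ∀ n : ℕ, N ≤ n →
      1 - δ ≤ erProb n (min (C / n) 1) (fun G =>
        ∃ V' : Finset (Fin n), (1 - ε) * n ≤ V'.card ∧
          GloballyRigid (G.induce (V' : Set (Fin n)))) := by
  intro ε hε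
  obtain ⟨γ, hγ, hγε, hγ11⟩ : ∃ γ : ℝ, 0 < γ ∧ γ ≤ ε ∧ γ ≤ 1 / 11 :=
    ⟨min ε (1 / 11), by positivity, min_le_left _ _, min_le_right _ _⟩
  refine ⟨16 / γ ^ 2, by positivity, fun δ hδ => ?_⟩
  refine ⟨⌈16 / γ ^ 2⌉₊ + ⌈2 / γ⌉₊ + ⌈1 / δ⌉₊ + 1, fun n hn => ?_⟩
  have hn₁ : 16 / γ ^ 2 ≤ n := (Nat.le_ceil _).trans (by exact_mod_cast (by omega))
  have hn₂ : 2 / γ ≤ n := (Nat.le_ceil _).trans (by exact_mod_cast (by omega))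
  have hn₃ : 1 / δ ≤ n := (Nat.le_ceil _).trans (by exact_mod_cast (by omega))
  have hn₀ : 0 < n := by omega
  have hn' : (0 : ℝ) < n := by exact_mod_cast hn₀
  have hp₁ : 16 / γ ^ 2 / n ≤ 1 := (div_le_one hn').2 hn₁
  have hp₀ : 0 ≤ 16 / γ ^ 2 / n := by positivity
  rw [min_eq_left hp₁]
  rw [div_le_iff₀ hγ] at hn₂
  have hfloor : (⌊γ * n⌋₊ : ℝ) ≤ γ * n := Nat.floor_le (by positivity)
  have hfloor' : γ * n < ⌊γ * n⌋₊ + 1 := Nat.lt_floor_add_one _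
  have hk₀ : 0 < ⌊γ * n⌋₊ := Nat.floor_pos.2 (by linarith)
  have hk11 : 11 * ⌊γ * n⌋₊ ≤ n := by
    have : (11 : ℝ) * ⌊γ * n⌋₊ ≤ n := by nlinarith
    exact_mod_cast this
  have hbound := four_pow_mul_one_sub_pow_le hγ hn₀ (k := ⌊γ * n⌋₊) (by linarith) hn₁
  have hδn : 1 / (n : ℝ) ≤ δ := (one_div_le hδ hn').1 hn₃
  calc 1 - δ ≤ 1 - 4 ^ n * (1 - 16 / γ ^ 2 / n) ^ (⌊γ * n⌋₊ * ⌊γ * n⌋₊) := by linarith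
    _ ≤ _ := le_erProb_hasCrossEdges hp₀ hp₁ _
    _ ≤ _ := erProb_mono hp₀ hp₁ fun G hG => ?_
  obtain ⟨V', hV', hrigid⟩ := hG.exists_globallyRigid_induce hk₀ (by simpa using hk11)
  refine ⟨V', ?_, hrigid⟩
  rw [Fintype.card_fin] at hV'
  have : (n : ℝ) ≤ V'.card + ⌊γ * n⌋₊ := by exact_mod_cast hV'
  nlinarith
end
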